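/- arXiv:2008.09489 — 4 statements merged into one kernel-verified Lean document; each statement's English description precedes it below -/
import Mathlib

section
/- Let G be a group, N a normal subgroup of G, and let π₁, π₂ be irreducible finite-dimensional complex representations of G. Then Hom_N(π₁, π₂) ≠ 0 if and only if the direct sum of d_{π₂} copies of the restriction π₁|_N is isomorphic, as a representation of N, to the direct sum of d_{π₁} copies of the restriction π₂|_N. -/
variable {G : Type*} [Group G]

/-- A finite-dimensional complex representation is irreducible if it is nonzero and has no
invariant subspace other than `⊥` and `⊤`. -/
def IsIrrep {V : Type*} [AddCommGroup V] [Module ℂ V] (ρ : Representation ℂ G V) : Prop :=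
  Nontrivial V ∧ ∀ p : Submodule ℂ V, (∀ g : G, ∀ v ∈ p, ρ g v ∈ p) → p = ⊥ ∨ p = ⊤

/-- The space of linear maps intertwining the restrictions to a subgroup `H`. -/
def homSpace (H : Subgroup G) {V₁ V₂ : Type*} [AddCommGroup V₁] [Module ℂ V₁]
    [AddCommGroup V₂] [Module ℂ V₂] (ρ₁ : Representation ℂ G V₁)
    (ρ₂ : Representation ℂ G V₂) : Submodule ℂ (V₁ →ₗ[ℂ] V₂) where
  carrier := {f | ∀ h ∈ H, ∀ v, f (ρ₁ h v) = ρ₂ h (f v)}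
  add_mem' := by
    intro f g hf hg h hh v
    simp [hf h hh v, hg h hh v]
  zero_mem' := by intro h hh v; simp
  smul_mem' := by
    intro c f hf h hh v
    simp [hf h hh v]

open Module

universe u v

section SemisimpleMultiplicity

variable {k A : Type*} [Field k] [Ring A] [Algebra k A]

theorem Submodule.finite_of_isScalarTower {M : Type*} [AddCommGroup M] [Module k M] [Module A M]
    [IsScalarTower k A M] [Module.Finite k M] (S : Submodule A M) : Module.Finite k S :=
  Module.Finite.of_injective (S.subtype.restrictScalars k) S.subtype_injective

/-- Linear maps from a simple module to a finite-dimensional module form a finite-dimensional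
space. -/
theorem IsSimpleModule.finite_linearMap {S M : Type*} [AddCommGroup S] [Module A S]
    [IsSimpleModule A S] [AddCommGroup M] [Module k M] [Module A M] [IsScalarTower k A M]
    [Module.Finite k M] : Module.Finite k (S →ₗ[A] M) := by
  have := IsSimpleModule.nontrivial A S
  obtain ⟨s, hs⟩ := exists_ne (0 : S)
  let ev : (S →ₗ[A] M) →ₗ[k] M :=
    { toFun := fun f => f s
      map_add' := fun _ _ => rfl
      map_smul' := fun _ _ => rfl }
  refine Module.Finite.of_injective ev fun f g (hfg : f s = g s) => ?_
  refine LinearMap.ext_on (IsSimpleModule.span_singleton_eq_top A hs) ?_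
  simpa [Set.EqOn] using hfg

variable (k) in
theorem LinearEquiv.finrank_linearMap_congr_left {S T M : Type*} [AddCommGroup S] [Module A S]
    [AddCommGroup T] [Module A T] [AddCommGroup M] [Module k M] [Module A M] [IsScalarTower k A M]
    (e : S ≃ₗ[A] T) : finrank k (S →ₗ[A] M) = finrank k (T →ₗ[A] M) :=
  LinearEquiv.finrank_eq
    { LinearMap.lcomp k M e.symm.toLinearMap with
      invFun := fun f => f ∘ₗ e.toLinearMap
      left_inv := fun f => by ext; simp
      right_inv := fun f => by ext; simp }

variable (k) in
theorem LinearEquiv.finrank_linearMap_congr_right {S M M' : Type*} [AddCommGroup S] [Module A S]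
    [AddCommGroup M] [Module k M] [Module A M] [IsScalarTower k A M]
    [AddCommGroup M'] [Module k M'] [Module A M'] [IsScalarTower k A M']
    (e : M ≃ₗ[A] M') : finrank k (S →ₗ[A] M) = finrank k (S →ₗ[A] M') :=
  LinearEquiv.finrank_eq
    { LinearMap.compRight k e.toLinearMap with
      invFun := fun f => e.symm.toLinearMap ∘ₗ f
      left_inv := fun f => by ext; simp
      right_inv := fun f => by ext; simp }

theorem IsSimpleModule.finrank_linearMap_prod {S M M' : Type*} [AddCommGroup S] [Module A S]
    [IsSimpleModule A S]
    [AddCommGroup M] [Module k M] [Module A M] [IsScalarTower k A M] [Module.Finite k M]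
    [AddCommGroup M'] [Module k M'] [Module A M'] [IsScalarTower k A M'] [Module.Finite k M'] :
    finrank k (S →ₗ[A] M × M') = finrank k (S →ₗ[A] M) + finrank k (S →ₗ[A] M') := by
  have : Module.Finite k (S →ₗ[A] M) := IsSimpleModule.finite_linearMap
  have : Module.Finite k (S →ₗ[A] M') := IsSimpleModule.finite_linearMap
  rw [← (LinearMap.prodEquiv (M := S) (M₂ := M) (M₃ := M') (R := A) k).finrank_eq, finrank_prod]

theorem IsSimpleModule.finrank_linearMap_pi {S M : Type*} [AddCommGroup S] [Module A S]
    [IsSimpleModule A S]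
    [AddCommGroup M] [Module k M] [Module A M] [IsScalarTower k A M] [Module.Finite k M] (n : ℕ) :
    finrank k (S →ₗ[A] Fin n → M) = n * finrank k (S →ₗ[A] M) := by
  have : Module.Finite k (S →ₗ[A] M) := IsSimpleModule.finite_linearMap
  rw [← (LinearEquiv.linearMapPi (R := A) (M₂ := S) (φ := fun _ : Fin n => M) k).finrank_eq,
    finrank_pi_fintype]
  simp

theorem IsSimpleModule.finrank_linearMap_ne_zero_iff {S M : Type*} [AddCommGroup S] [Module A S]
    [IsSimpleModule A S]
    [AddCommGroup M] [Module k M] [Module A M] [IsScalarTower k A M] [Module.Finite k M] :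
    finrank k (S →ₗ[A] M) ≠ 0 ↔ ∃ f : S →ₗ[A] M, f ≠ 0 := by
  have : Module.Finite k (S →ₗ[A] M) := IsSimpleModule.finite_linearMap
  rw [← Nat.pos_iff_ne_zero, finrank_pos_iff, nontrivial_iff_exists_ne 0]

theorem IsSimpleModule.subtype_ne_zero {M : Type*} [AddCommGroup M] [Module A M]
    (S : Submodule A M) [IsSimpleModule A S] : S.subtype ≠ 0 := by
  have := IsSimpleModule.nontrivial A S
  obtain ⟨s, hs⟩ := exists_ne (0 : S)
  exact fun h0 => hs (Subtype.ext (LinearMap.congr_fun h0 s))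

variable (k) in
/-- If every simple module occurs in the semisimple module `M` at most as often as in `M'`, then
`M` embeds into `M'`. -/
theorem exists_injective_of_finrank_linearMap_le {M : Type u} {M' : Type v}
    [AddCommGroup M] [Module k M] [Module A M] [IsScalarTower k A M] [Module.Finite k M]
    [AddCommGroup M'] [Module k M'] [Module A M'] [IsScalarTower k A M'] [Module.Finite k M']
    [IsSemisimpleModule A M] [IsSemisimpleModule A M']
    (h : ∀ (S : Type u) [AddCommGroup S] [Module A S] [IsSimpleModule A S],
      finrank k (S →ₗ[A] M) ≤ finrank k (S →ₗ[A] M')) :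
    ∃ f : M →ₗ[A] M', Function.Injective f := by
  induction hn : finrank k M using Nat.strong_induction_on generalizing M M' with
  | _ n ih =>
  rcases subsingleton_or_nontrivial M with hM | hM
  · exact ⟨0, Function.injective_of_subsingleton _⟩
  obtain ⟨S, hS⟩ := IsSemisimpleModule.exists_simple_submodule A M
  have := IsSimpleModule.nontrivial A S
  have hS₀ : finrank k (S →ₗ[A] M) ≠ 0 :=
    IsSimpleModule.finrank_linearMap_ne_zero_iff.2 ⟨_, IsSimpleModule.subtype_ne_zero S⟩
  have hS₁ : finrank k (S →ₗ[A] M') ≠ 0 := ((Nat.pos_of_ne_zero hS₀).trans_le (h S)).ne'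
  obtain ⟨f, hf⟩ := IsSimpleModule.finrank_linearMap_ne_zero_iff.1 hS₁
  have hfi := LinearMap.injective_of_ne_zero hf
  obtain ⟨C, hC⟩ := exists_isCompl S
  obtain ⟨C', hC'⟩ := exists_isCompl (LinearMap.range f)
  let e : (S × C) ≃ₗ[A] M := Submodule.prodEquivOfIsCompl _ _ hC
  let e' : (S × C') ≃ₗ[A] M' :=
    ((LinearEquiv.ofInjective f hfi).prodCongr (LinearEquiv.refl A C')).trans
      (Submodule.prodEquivOfIsCompl _ _ hC')
  have : Module.Finite k S := S.finite_of_isScalarTower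
  have : Module.Finite k C := C.finite_of_isScalarTower
  have : Module.Finite k C' := C'.finite_of_isScalarTower
  have hlt : finrank k C < n := by
    have h₁ := (e.restrictScalars k).finrank_eq
    have h₂ : 0 < finrank k S := finrank_pos
    rw [finrank_prod] at h₁
    omega
  obtain ⟨j, hj⟩ := ih (finrank k C) hlt (M := C) (M' := C') (fun T _ _ _ => by
    have hT := h T
    rw [← e.finrank_linearMap_congr_right k, ← e'.finrank_linearMap_congr_right k,
      IsSimpleModule.finrank_linearMap_prod, IsSimpleModule.finrank_linearMap_prod] at hT
    omega) rfl
  exact ⟨e'.toLinearMap ∘ₗ (LinearMap.id.prodMap j) ∘ₗ e.symm.toLinearMap,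
    e'.injective.comp ((Function.injective_id.prodMap hj).comp e.symm.injective)⟩

variable (k) in
/-- If the multiplicities of simple modules in two semisimple modules are in a fixed proportion,
then the modules become isomorphic after taking as many copies of each as the dimension of
the other. -/
theorem nonempty_linearEquiv_of_finrank_linearMap_proportional {M : Type u} {M' : Type v}
    [AddCommGroup M] [Module k M] [Module A M] [IsScalarTower k A M] [Module.Finite k M]
    [AddCommGroup M'] [Module k M'] [Module A M'] [IsScalarTower k A M'] [Module.Finite k M']
    [IsSemisimpleModule A M] [IsSemisimpleModule A M'] {a b : ℕ} (hb : b ≠ 0)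
    (h : ∀ (S : Type u) [AddCommGroup S] [Module A S] [IsSimpleModule A S],
      b * finrank k (S →ₗ[A] M) = a * finrank k (S →ₗ[A] M'))
    (h' : ∀ (S : Type v) [AddCommGroup S] [Module A S] [IsSimpleModule A S],
      b * finrank k (S →ₗ[A] M) = a * finrank k (S →ₗ[A] M')) :
    Nonempty ((Fin (finrank k M') → M) ≃ₗ[A] (Fin (finrank k M) → M')) := by
  obtain ⟨f, hf⟩ := exists_injective_of_finrank_linearMap_le k (A := A) (M := Fin b → M)
    (M' := Fin a → M') fun S _ _ _ => by
      rw [IsSimpleModule.finrank_linearMap_pi, IsSimpleModule.finrank_linearMap_pi, h S]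
  obtain ⟨f', hf'⟩ := exists_injective_of_finrank_linearMap_le k (A := A) (M := Fin a → M')
    (M' := Fin b → M) fun S _ _ _ => by
      rw [IsSimpleModule.finrank_linearMap_pi, IsSimpleModule.finrank_linearMap_pi, h' S]
  have hle := LinearMap.finrank_le_finrank_of_injective (f := f.restrictScalars k) hf
  have hle' := LinearMap.finrank_le_finrank_of_injective (f := f'.restrictScalars k) hf'
  simp only [finrank_pi_fintype, Finset.sum_const, Finset.card_univ, Fintype.card_fin,
    smul_eq_mul] at hle hle'
  have hdim : b * finrank k M = a * finrank k M' := le_antisymm hle hle'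
  obtain ⟨j, hj⟩ := exists_injective_of_finrank_linearMap_le k (A := A)
    (M := Fin (finrank k M') → M) (M' := Fin (finrank k M) → M') fun S _ _ _ => by
      rw [IsSimpleModule.finrank_linearMap_pi, IsSimpleModule.finrank_linearMap_pi]
      refine le_of_eq (Nat.eq_of_mul_eq_mul_left (Nat.pos_of_ne_zero hb) ?_)
      rw [mul_left_comm, h S, ← mul_assoc, ← mul_assoc, hdim, mul_comm a]
  have hj' : Function.Surjective (j.restrictScalars k) :=
    (LinearMap.injective_iff_surjective_of_finrank_eq_finrank
      (by simp [finrank_pi_fintype, mul_comm])).1 hj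
  exact ⟨LinearEquiv.ofBijective j ⟨hj, hj'⟩⟩

end SemisimpleMultiplicity

section Twist

variable {k A Γ : Type*} [Field k] [Ring A] [Group Γ] {σ : Γ → A ≃+* A}
  {V : Type u} [AddCommGroup V] [Module k V] [Module A V] {ρ : Representation k Γ V}

/-- The operator of a group element, as a semilinear map over the twisting automorphism of `A`. -/
def twistMap (hρ : ∀ g (a : A) v, ρ g (a • v) = σ g a • ρ g v) (g : Γ) :
    V →ₛₗ[(σ g : A →+* A)] V where
  toFun := ρ g
  map_add' := map_add _
  map_smul' := hρ g

@[simp]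
theorem twistMap_apply (hρ : ∀ g (a : A) v, ρ g (a • v) = σ g a • ρ g v) (g : Γ) (v : V) :
    twistMap hρ g v = ρ g v :=
  rfl

theorem twistMap_bijective (hρ : ∀ g (a : A) v, ρ g (a • v) = σ g a • ρ g v) (g : Γ) :
    Function.Bijective (twistMap hρ g) :=
  ρ.apply_bijective g

theorem map_twistMap_inv (hρ : ∀ g (a : A) v, ρ g (a • v) = σ g a • ρ g v) (g : Γ)
    (T : Submodule A V) : (T.map (twistMap hρ g)).map (twistMap hρ g⁻¹) = T := by
  ext v
  simp

theorem isSimpleModule_map_twistMap (hρ : ∀ g (a : A) v, ρ g (a • v) = σ g a • ρ g v) (g : Γ)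
    (T : Submodule A V) [IsSimpleModule A T] : IsSimpleModule A (T.map (twistMap hρ g)) := by
  let l : T →ₛₗ[(σ g : A →+* A)] T.map (twistMap hρ g) :=
    (twistMap hρ g).restrict fun v hv => Submodule.mem_map_of_mem hv
  refine (l.isSimpleModule_iff_of_bijective ⟨fun x y hxy => ?_, ?_⟩).1 inferInstance
  · exact Subtype.ext ((twistMap_bijective hρ g).1 (congrArg Subtype.val hxy))
  · rintro ⟨_, v, hv, rfl⟩
    exact ⟨⟨v, hv⟩, rfl⟩

variable [Algebra k A]
  {W : Type v} [AddCommGroup W] [Module k W] [Module A W] [IsScalarTower k A W]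
  {τ : Representation k Γ W}

theorem finrank_linearMap_map_twistMap_le [Module.Finite k W]
    (hρ : ∀ g (a : A) v, ρ g (a • v) = σ g a • ρ g v)
    (hτ : ∀ g (a : A) v, τ g (a • v) = σ g a • τ g v) (g : Γ)
    (T : Submodule A V) [IsSimpleModule A T] :
    finrank k (T.map (twistMap hρ g) →ₗ[A] W) ≤ finrank k (T →ₗ[A] W) := by
  have : Module.Finite k (T →ₗ[A] W) := IsSimpleModule.finite_linearMap
  let l : T →ₛₗ[(σ g : A →+* A)] T.map (twistMap hρ g) :=
    (twistMap hρ g).restrict fun v hv => Submodule.mem_map_of_mem hv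
  have hl : Function.Surjective l := by
    rintro ⟨_, v, hv, rfl⟩
    exact ⟨⟨v, hv⟩, rfl⟩
  let Φ : (T.map (twistMap hρ g) →ₗ[A] W) →ₗ[k] (T →ₗ[A] W) :=
    { toFun := fun f =>
        { toFun := fun t => τ g⁻¹ (f (l t))
          map_add' := fun x y => by simp
          map_smul' := fun a x => by
            apply (τ.apply_bijective g).1
            rw [τ.self_inv_apply, RingHom.id_apply, hτ, τ.self_inv_apply, map_smulₛₗ, map_smul]
            rfl }
      map_add' := fun f f' => by ext; simp
      map_smul' := fun c f => by ext; simp }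
  refine LinearMap.finrank_le_finrank_of_injective (f := Φ) fun f f' hff' => ?_
  ext x
  obtain ⟨t, rfl⟩ := hl x
  exact (τ.apply_bijective g⁻¹).1 (LinearMap.congr_fun hff' t)

theorem finrank_linearMap_map_twistMap [Module.Finite k W]
    (hρ : ∀ g (a : A) v, ρ g (a • v) = σ g a • ρ g v)
    (hτ : ∀ g (a : A) v, τ g (a • v) = σ g a • τ g v) (g : Γ)
    (T : Submodule A V) [IsSimpleModule A T] :
    finrank k (T.map (twistMap hρ g) →ₗ[A] W) = finrank k (T →ₗ[A] W) := by
  refine le_antisymm (finrank_linearMap_map_twistMap_le hρ hτ g T) ?_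
  have := isSimpleModule_map_twistMap hρ g T
  have h := finrank_linearMap_map_twistMap_le hρ hτ g⁻¹ (T.map (twistMap hρ g))
  rwa [map_twistMap_inv] at h

variable [IsScalarTower k A V]

/-- The translates of a nonzero submodule under an irreducible group span the whole space. -/
theorem iSup_map_twistMap_eq_top (hρ : ∀ g (a : A) v, ρ g (a • v) = σ g a • ρ g v)
    (hirr : ∀ p : Submodule k V, (∀ g, ∀ v ∈ p, ρ g v ∈ p) → p = ⊥ ∨ p = ⊤)
    (T : Submodule A V) (hT : T ≠ ⊥) : ⨆ g, T.map (twistMap hρ g) = ⊤ := by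
  have hle : T ≤ ⨆ g, T.map (twistMap hρ g) := fun v hv =>
    Submodule.mem_iSup_of_mem 1 ⟨v, hv, by simp⟩
  have hinv : ∀ g, ∀ v ∈ (⨆ g, T.map (twistMap hρ g)).restrictScalars k,
      ρ g v ∈ (⨆ g, T.map (twistMap hρ g)).restrictScalars k := by
    intro g
    suffices ⨆ h, T.map (twistMap hρ h) ≤ (⨆ h, T.map (twistMap hρ h)).comap (twistMap hρ g) from
      fun v hv => this hv
    refine iSup_le fun h => ?_
    rintro _ ⟨v, hv, rfl⟩
    exact Submodule.mem_iSup_of_mem (g * h) ⟨v, hv, by simp⟩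
  rcases hirr _ hinv with h | h
  · rw [Submodule.restrictScalars_eq_bot_iff] at h
    exact absurd (le_bot_iff.1 (h ▸ hle)) hT
  · rwa [Submodule.restrictScalars_eq_top_iff] at h

theorem exists_isSimpleModule_submodule [Module.Finite k V] [Nontrivial V] :
    ∃ T : Submodule A V, IsSimpleModule A T := by
  have : IsArtinian A V := isArtinian_of_tower k inferInstance
  obtain ⟨T, hT⟩ := IsAtomic.exists_atom (Submodule A V)
  exact ⟨T, isSimpleModule_iff_isAtom.2 hT⟩

theorem isSemisimpleModule_of_irreducible [Module.Finite k V] [Nontrivial V]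
    (hρ : ∀ g (a : A) v, ρ g (a • v) = σ g a • ρ g v)
    (hirr : ∀ p : Submodule k V, (∀ g, ∀ v ∈ p, ρ g v ∈ p) → p = ⊥ ∨ p = ⊤) :
    IsSemisimpleModule A V := by
  obtain ⟨T, hT⟩ := exists_isSimpleModule_submodule (k := k) (A := A) (V := V)
  exact isSemisimpleModule_of_isSemisimpleModule_submodule'
    (fun g => have := isSimpleModule_map_twistMap hρ g T; inferInstance)
    (iSup_map_twistMap_eq_top hρ hirr T (isSimpleModule_iff_isAtom.1 hT).1)

/-- Any two simple modules mapping nontrivially to an irreducible representation have the same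
multiplicity in any representation of the big group. -/
theorem finrank_linearMap_eq_of_ne_zero [Module.Finite k W]
    (hρ : ∀ g (a : A) v, ρ g (a • v) = σ g a • ρ g v)
    (hτ : ∀ g (a : A) v, τ g (a • v) = σ g a • τ g v)
    (hirr : ∀ p : Submodule k V, (∀ g, ∀ v ∈ p, ρ g v ∈ p) → p = ⊥ ∨ p = ⊤)
    {S : Type*} [AddCommGroup S] [Module A S] [IsSimpleModule A S]
    {T : Type*} [AddCommGroup T] [Module A T] [IsSimpleModule A T]
    {f : S →ₗ[A] V} (hf : f ≠ 0) {f' : T →ₗ[A] V} (hf' : f' ≠ 0) :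
    finrank k (S →ₗ[A] W) = finrank k (T →ₗ[A] W) := by
  let e := LinearEquiv.ofInjective f (LinearMap.injective_of_ne_zero hf)
  let e' := LinearEquiv.ofInjective f' (LinearMap.injective_of_ne_zero hf')
  have hS : IsSimpleModule A (LinearMap.range f) := IsSimpleModule.congr e.symm
  have hT : IsSimpleModule A (LinearMap.range f') := IsSimpleModule.congr e'.symm
  have hsimple : ∀ m : Set.range fun g => (LinearMap.range f').map (twistMap hρ g),
      IsSimpleModule A m := by
    rintro ⟨_, g, rfl⟩
    exact isSimpleModule_map_twistMap hρ g _
  obtain ⟨_, ⟨g, rfl⟩, ⟨i⟩⟩ := (LinearMap.range f).linearEquiv_of_sSup_eq_top _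
    (iSup_map_twistMap_eq_top hρ hirr _ (isSimpleModule_iff_isAtom.1 hT).1)
  rw [e.finrank_linearMap_congr_left k, e'.finrank_linearMap_congr_left k,
    i.finrank_linearMap_congr_left k, finrank_linearMap_map_twistMap hρ hτ]

/-- If a simple module maps nontrivially to two irreducible representations, then the
multiplicities of all simple modules in them are in a fixed proportion. -/
theorem finrank_linearMap_mul_eq_mul [Module.Finite k V] [Module.Finite k W]
    (hρ : ∀ g (a : A) v, ρ g (a • v) = σ g a • ρ g v)
    (hτ : ∀ g (a : A) v, τ g (a • v) = σ g a • τ g v)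
    (hρirr : ∀ p : Submodule k V, (∀ g, ∀ v ∈ p, ρ g v ∈ p) → p = ⊥ ∨ p = ⊤)
    (hτirr : ∀ p : Submodule k W, (∀ g, ∀ v ∈ p, τ g v ∈ p) → p = ⊥ ∨ p = ⊤)
    {T : Type*} [AddCommGroup T] [Module A T] [IsSimpleModule A T]
    {f : T →ₗ[A] V} (hf : f ≠ 0) {f' : T →ₗ[A] W} (hf' : f' ≠ 0)
    (S : Type*) [AddCommGroup S] [Module A S] [IsSimpleModule A S] :
    finrank k (T →ₗ[A] W) * finrank k (S →ₗ[A] V) =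
      finrank k (T →ₗ[A] V) * finrank k (S →ₗ[A] W) := by
  by_cases hV : finrank k (S →ₗ[A] V) = 0
  · by_cases hW : finrank k (S →ₗ[A] W) = 0
    · rw [hV, hW, mul_zero, mul_zero]
    · obtain ⟨j, hj⟩ := IsSimpleModule.finrank_linearMap_ne_zero_iff.1 hW
      rw [finrank_linearMap_eq_of_ne_zero hτ hρ hτirr hj hf',
        finrank_linearMap_eq_of_ne_zero hτ hτ hτirr hj hf', mul_comm]
  · obtain ⟨j, hj⟩ := IsSimpleModule.finrank_linearMap_ne_zero_iff.1 hV
    rw [finrank_linearMap_eq_of_ne_zero hρ hρ hρirr hj hf,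
      finrank_linearMap_eq_of_ne_zero hρ hτ hρirr hj hf, mul_comm]

/-- If two irreducible representations admit a nonzero `A`-linear map between them, they become
isomorphic over `A` after taking as many copies of each as the dimension of the other. -/
theorem nonempty_linearEquiv_of_linearMap_ne_zero [Module.Finite k V] [Module.Finite k W]
    [Nontrivial V] [Nontrivial W]
    (hρ : ∀ g (a : A) v, ρ g (a • v) = σ g a • ρ g v)
    (hτ : ∀ g (a : A) v, τ g (a • v) = σ g a • τ g v)
    (hρirr : ∀ p : Submodule k V, (∀ g, ∀ v ∈ p, ρ g v ∈ p) → p = ⊥ ∨ p = ⊤)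
    (hτirr : ∀ p : Submodule k W, (∀ g, ∀ v ∈ p, τ g v ∈ p) → p = ⊥ ∨ p = ⊤)
    {f : V →ₗ[A] W} (hf : f ≠ 0) :
    Nonempty ((Fin (finrank k W) → V) ≃ₗ[A] (Fin (finrank k V) → W)) := by
  have := isSemisimpleModule_of_irreducible hρ hρirr
  have := isSemisimpleModule_of_irreducible hτ hτirr
  obtain ⟨T, hT, hfT⟩ : ∃ T : Submodule A V, IsSimpleModule A T ∧ f.domRestrict T ≠ 0 := by
    by_contra! hcon
    refine hf (LinearMap.ker_eq_top.1 (top_le_iff.1 ?_))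
    rw [← IsSemisimpleModule.sSup_simples_eq_top A V]
    exact sSup_le fun T hT v hv => LinearMap.congr_fun (hcon T hT) ⟨v, hv⟩
  have hW : finrank k (T →ₗ[A] W) ≠ 0 :=
    IsSimpleModule.finrank_linearMap_ne_zero_iff.2 ⟨_, hfT⟩
  exact nonempty_linearEquiv_of_finrank_linearMap_proportional k hW
    (fun S _ _ _ => finrank_linearMap_mul_eq_mul hρ hτ hρirr hτirr
      (IsSimpleModule.subtype_ne_zero T) hfT S)
    (fun S _ _ _ => finrank_linearMap_mul_eq_mul hρ hτ hρirr hτirr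
      (IsSimpleModule.subtype_ne_zero T) hfT S)

end Twist

section Restriction

open scoped MonoidAlgebra

variable {Γ : Type*} [Group Γ] {V : Type*} [AddCommGroup V] [Module ℂ V]

/-- The module over the group algebra of a subgroup given by restricting a representation. -/
noncomputable abbrev restrictModule (N : Subgroup Γ) (ρ : Representation ℂ Γ V) : Module ℂ[N] V :=
  Module.compHom V (Representation.asAlgebraHom (ρ.comp N.subtype)).toRingHom

/-- Conjugation by a group element on the group algebra of a normal subgroup. -/
noncomputable def conjGroupAlgebra (N : Subgroup Γ) [N.Normal] (g : Γ) : ℂ[N] ≃+* ℂ[N] :=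
  (MonoidAlgebra.domCongr ℂ ℂ (MulAut.conjNormal g)).toRingEquiv

theorem asAlgebraHom_conjGroupAlgebra (N : Subgroup Γ) [N.Normal] (ρ : Representation ℂ Γ V)
    (g : Γ) (a : ℂ[N]) (v : V) :
    ρ g (Representation.asAlgebraHom (ρ.comp N.subtype) a v) =
      Representation.asAlgebraHom (ρ.comp N.subtype) (conjGroupAlgebra N g a) (ρ g v) := by
  induction a using MonoidAlgebra.induction_linear with
  | zero => simp
  | add a b ha hb => simp [ha, hb]
  | single n c =>
    simp [conjGroupAlgebra, Representation.asAlgebraHom_single, ← Module.End.mul_apply, ← map_mul]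

end Restriction

/-- `Hom_N(π₁, π₂) ≠ 0` iff `d_{π₂}` copies of `π₁|_N` is isomorphic, as a
representation of `N`, to `d_{π₁}` copies of `π₂|_N`. -/
theorem stmt0 {V₁ V₂ : Type*} [AddCommGroup V₁] [Module ℂ V₁] [FiniteDimensional ℂ V₁]
    [AddCommGroup V₂] [Module ℂ V₂] [FiniteDimensional ℂ V₂]
    (N : Subgroup G) [N.Normal]
    (ρ₁ : Representation ℂ G V₁) (ρ₂ : Representation ℂ G V₂)
    (h₁ : IsIrrep ρ₁) (h₂ : IsIrrep ρ₂) :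
    homSpace N ρ₁ ρ₂ ≠ ⊥ ↔
      ∃ e : (Fin (Module.finrank ℂ V₂) → V₁) ≃ₗ[ℂ] (Fin (Module.finrank ℂ V₁) → V₂),
        ∀ n ∈ N, ∀ x : Fin (Module.finrank ℂ V₂) → V₁,
          e (fun i => ρ₁ n (x i)) = fun i => ρ₂ n (e x i) := by
  constructor
  · intro hne
    obtain ⟨f, hf, hf₀⟩ := Submodule.exists_mem_ne_zero_of_ne_bot hne
    have := h₁.1
    have := h₂.1
    let := restrictModule N ρ₁
    let := restrictModule N ρ₂
    have smul₁ (a : MonoidAlgebra ℂ N) (v : V₁) :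
        a • v = Representation.asAlgebraHom (ρ₁.comp N.subtype) a v := rfl
    have smul₂ (a : MonoidAlgebra ℂ N) (v : V₂) :
        a • v = Representation.asAlgebraHom (ρ₂.comp N.subtype) a v := rfl
    have : IsScalarTower ℂ (MonoidAlgebra ℂ N) V₁ := ⟨fun c a v => by simp [smul₁]⟩
    have : IsScalarTower ℂ (MonoidAlgebra ℂ N) V₂ := ⟨fun c a v => by simp [smul₂]⟩
    let F : V₁ →ₗ[MonoidAlgebra ℂ N] V₂ :=
      { f with
        map_smul' := fun a v => by
          change f (a • v) = a • f v
          induction a using MonoidAlgebra.induction_linear with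
          | zero => simp
          | add a b ha hb => simp [add_smul, ha, hb]
          | single n c =>
            simp [smul₁, smul₂, Representation.asAlgebraHom_single, hf n n.2 v] }
    have hF : F ≠ 0 := fun h => hf₀ (LinearMap.ext fun v => LinearMap.congr_fun h v)
    obtain ⟨e⟩ := nonempty_linearEquiv_of_linearMap_ne_zero (k := ℂ)
      (asAlgebraHom_conjGroupAlgebra N ρ₁) (asAlgebraHom_conjGroupAlgebra N ρ₂) h₁.2 h₂.2 hF
    refine ⟨e.restrictScalars ℂ, fun n hn x => ?_⟩
    have h := e.map_smul (MonoidAlgebra.single (⟨n, hn⟩ : N) 1) x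
    convert h using 1
    · change e _ = e _
      congr 1
      ext i
      simp [smul₁, Representation.asAlgebraHom_single]
    · ext i
      simp [smul₂, Representation.asAlgebraHom_single]
  · rintro ⟨e, he⟩ hbot
    have := h₁.1
    have := h₂.1
    have hzero : ∀ i j v, e (Pi.single i v) j = 0 := by
      intro i j v
      have hmem : LinearMap.proj j ∘ₗ e.toLinearMap ∘ₗ LinearMap.single ℂ (fun _ => V₁) i ∈
          homSpace N ρ₁ ρ₂ := by
        intro n hn w
        have h := congrFun (he n hn (Pi.single i w)) j
        have hs : (fun l => ρ₁ n ((Pi.single i w : Fin (Module.finrank ℂ V₂) → V₁) l)) =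
            Pi.single i (ρ₁ n w) := by
          ext l
          exact Pi.apply_single (fun _ => ρ₁ n) (fun _ => map_zero _) i w l
        rw [hs] at h
        exact h
      rw [hbot, Submodule.mem_bot] at hmem
      exact LinearMap.congr_fun hmem v
    obtain ⟨v, hv⟩ := exists_ne (0 : V₁)
    have hpos : 0 < Module.finrank ℂ V₂ := Module.finrank_pos
    have h0 : (Pi.single ⟨0, hpos⟩ v : Fin (Module.finrank ℂ V₂) → V₁) = 0 :=
      e.map_eq_zero_iff.1 (funext fun j => hzero _ j v)
    exact hv (by simpa using congrFun h0 ⟨0, hpos⟩)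
end

section
/- Let G be a group, N a normal subgroup of G, and let π₁, π₂ be irreducible finite-dimensional complex representations of G with Hom_N(π₁, π₂) ≠ 0. Let σ be an irreducible N-subrepresentation of the restriction π₁|_N, let d_σ be its dimension, and let k be the number of isomorphism classes of irreducible N-subrepresentations of π₁|_N. Then k · d_σ² · dim Hom_N(π₁, π₂) = d_{π₁} · d_{π₂}. -/
variable {G : Type*} [Group G]

/-- `p` is an irreducible `N`-subrepresentation of the restriction of `ρ` to `N`. -/
def IsIrredSub (N : Subgroup G) {V : Type*} [AddCommGroup V] [Module ℂ V]
    (ρ : Representation ℂ G V) (p : Submodule ℂ V) : Prop :=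
  p ≠ ⊥ ∧ (∀ n ∈ N, ∀ v ∈ p, ρ n v ∈ p) ∧
    ∀ q : Submodule ℂ V, q ≤ p → (∀ n ∈ N, ∀ v ∈ q, ρ n v ∈ q) → q = ⊥ ∨ q = p

/-- Two invariant subspaces are isomorphic as `N`-representations. -/
def SubRepIso (N : Subgroup G) {V₁ V₂ : Type*} [AddCommGroup V₁] [Module ℂ V₁]
    [AddCommGroup V₂] [Module ℂ V₂] (ρ₁ : Representation ℂ G V₁)
    (ρ₂ : Representation ℂ G V₂) (p : Submodule ℂ V₁) (p' : Submodule ℂ V₂) : Prop :=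
  ∃ e : p ≃ₗ[ℂ] p', ∀ n ∈ N, ∀ v w : p, ρ₁ n (v : V₁) = (w : V₁) →
    ρ₂ n (e v : V₂) = (e w : V₂)

/-- The number of isomorphism classes of irreducible `N`-subrepresentations of `ρ|_N`. -/
noncomputable def numIrredClasses (N : Subgroup G) {V : Type*} [AddCommGroup V] [Module ℂ V]
    (ρ : Representation ℂ G V) : ℕ :=
  Nat.card (Quot (fun p q : {p : Submodule ℂ V // IsIrredSub N ρ p} =>
    SubRepIso N ρ ρ p.1 q.1))

/-! ### Multiplicities in semisimple modules -/

section Multiplicity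

variable {k A : Type*} [Field k] [Ring A] [Algebra k A]

/-- Schur's lemma: between simple modules over an algebraically closed field, homomorphism spaces
have dimension one or zero. -/
theorem finrank_linearMap_of_isSimpleModule [IsAlgClosed k] {S T : Type*}
    [AddCommGroup S] [Module k S] [Module A S] [IsScalarTower k A S]
    [AddCommGroup T] [Module k T] [Module A T] [IsScalarTower k A T]
    [FiniteDimensional k S] [IsSimpleModule A S] [IsSimpleModule A T]
    [Decidable (Nonempty (S ≃ₗ[A] T))] :
    Module.finrank k (S →ₗ[A] T) = if Nonempty (S ≃ₗ[A] T) then 1 else 0 := by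
  split_ifs with h
  · obtain ⟨e⟩ := h
    have : FiniteDimensional k T := .of_surjective (e.toLinearMap.restrictScalars k) e.surjective
    have hbij := IsSimpleModule.algebraMap_end_bijective_of_isAlgClosed (A := A) (V := T) k
    rw [(LinearEquiv.congrLeft T k e).finrank_eq, ← Module.finrank_self k]
    exact (LinearEquiv.ofBijective (Algebra.linearMap k (Module.End A T)) hbij).finrank_eq.symm
  · have : Subsingleton (S →ₗ[A] T) := by
      refine subsingleton_of_forall_eq 0 fun f => by_contra fun hf => h ?_
      exact ⟨.ofBijective f (LinearMap.bijective_of_ne_zero hf)⟩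
    exact Module.finrank_zero_of_subsingleton

variable (k A) in
/-- A finite-dimensional semisimple module is a finite product of simple submodules. -/
theorem IsSemisimpleModule.exists_linearEquiv_fin_pi (V : Type*) [AddCommGroup V] [Module k V]
    [Module A V] [IsScalarTower k A V] [FiniteDimensional k V] [IsSemisimpleModule A V] :
    ∃ (n : ℕ) (S : Fin n → Submodule A V) (_ : V ≃ₗ[A] ∀ i, S i), ∀ i, IsSimpleModule A (S i) := by
  have : Module.Finite A V := Module.Finite.of_restrictScalars_finite k A V
  obtain ⟨n, S, e, hS⟩ := IsSemisimpleModule.exists_linearEquiv_fin_dfinsupp A V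
  exact ⟨n, S, e.trans DFinsupp.linearEquivFunOnFintype, hS⟩

variable {V W : Type*} [AddCommGroup V] [Module k V] [Module A V] [IsScalarTower k A V]
  [AddCommGroup W] [Module k W] [Module A W] [IsScalarTower k A W]

theorem finite_linearMap_of_isScalarTower [FiniteDimensional k V] [FiniteDimensional k W] :
    Module.Finite k (V →ₗ[A] W) :=
  .of_injective (LinearMap.restrictScalarsₗ k A V W k) (LinearMap.restrictScalars_injective _)

/-- If the simple submodules of `V` have constant dimension `d` and constant multiplicity `m` in
`W`, then `d * dim Hom(V, W) = m * dim V`. -/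
theorem mul_finrank_linearMap_eq [FiniteDimensional k V] [FiniteDimensional k W]
    [IsSemisimpleModule A V] {d m : ℕ}
    (hd : ∀ S : Submodule A V, IsSimpleModule A S → Module.finrank k S = d)
    (hm : ∀ S : Submodule A V, IsSimpleModule A S → Module.finrank k (S →ₗ[A] W) = m) :
    d * Module.finrank k (V →ₗ[A] W) = m * Module.finrank k V := by
  obtain ⟨n, S, e, hS⟩ := IsSemisimpleModule.exists_linearEquiv_fin_pi k A V
  have (i : Fin n) : Module.Finite k (S i →ₗ[A] W) := by
    have : Module.Finite k (S i) := inferInstanceAs (Module.Finite k ((S i).restrictScalars k))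
    exact finite_linearMap_of_isScalarTower
  have (i : Fin n) : Module.Finite k (S i) :=
    inferInstanceAs (Module.Finite k ((S i).restrictScalars k))
  have h1 : Module.finrank k V = n * d := by
    rw [(e.restrictScalars k).finrank_eq, Module.finrank_pi_fintype]
    simp [fun i => hd (S i) (hS i)]
  have h2 : Module.finrank k (V →ₗ[A] W) = n * m := by
    rw [((LinearEquiv.congrLeft W k e).trans
      (LinearMap.lsum A (fun i => S i) k).symm).finrank_eq, Module.finrank_pi_fintype]
    simp [fun i => hm (S i) (hS i)]
  rw [h1, h2]
  ring

/-- Suppose `cls` classifies the simple submodules of `V` up to isomorphism, they all have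
dimension `d` and multiplicity `m ≠ 0` in `W`, and every simple submodule of `W` is isomorphic to
one of them. Then the number of classes times `d * m` is `dim W`. -/
theorem card_classes_mul_eq_finrank [IsAlgClosed k] [FiniteDimensional k V] [FiniteDimensional k W]
    [IsSemisimpleModule A W] {d m : ℕ} {Q : Type*}
    (cls : {S : Submodule A V // IsSimpleModule A S} → Q) (hsurj : Function.Surjective cls)
    (hcls : ∀ S S', cls S = cls S' ↔ Nonempty (S.1 ≃ₗ[A] S'.1))
    (hd : ∀ S : Submodule A V, IsSimpleModule A S → Module.finrank k S = d)
    (hm : ∀ S : Submodule A V, IsSimpleModule A S → Module.finrank k (S →ₗ[A] W) = m)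
    (hm0 : m ≠ 0)
    (hW : ∀ T : Submodule A W, IsSimpleModule A T →
      ∃ S : Submodule A V, IsSimpleModule A S ∧ Nonempty (S ≃ₗ[A] T)) :
    Nat.card Q * d * m = Module.finrank k W := by
  classical
  obtain ⟨n, T, e, hT⟩ := IsSemisimpleModule.exists_linearEquiv_fin_pi k A W
  have (i : Fin n) : Module.Finite k (T i) :=
    inferInstanceAs (Module.Finite k ((T i).restrictScalars k))
  choose S hS hST using fun i => hW (T i) (hT i)
  let f : Fin n → Q := fun i => cls ⟨S i, hS i⟩
  have hdim : Module.finrank k W = n * d := by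
    have (i : Fin n) : Module.finrank k (T i) = d := by
      rw [← hd _ (hS i)]
      exact ((hST i).some.restrictScalars k).finrank_eq.symm
    rw [(e.restrictScalars k).finrank_eq, Module.finrank_pi_fintype]
    simp [this]
  have hfib (q : Q) : (Finset.univ.filter fun i => f i = q).card = m := by
    obtain ⟨⟨P, hP⟩, rfl⟩ := hsurj q
    have : Module.Finite k P := inferInstanceAs (Module.Finite k (P.restrictScalars k))
    have (i : Fin n) : Module.Finite k (P →ₗ[A] T i) := finite_linearMap_of_isScalarTower
    have hiff (i : Fin n) : f i = cls ⟨P, hP⟩ ↔ Nonempty (P ≃ₗ[A] T i) := by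
      rw [hcls]
      exact ⟨fun ⟨u⟩ => ⟨u.symm.trans (hST i).some⟩, fun ⟨u⟩ => ⟨(hST i).some.trans u.symm⟩⟩
    have e' : (P →ₗ[A] W) ≃ₗ[k] ∀ i, P →ₗ[A] T i :=
      LinearEquiv.ofBijective
        ({ toFun := fun φ i => LinearMap.proj i ∘ₗ e.toLinearMap ∘ₗ φ
           map_add' := fun φ ψ => by ext; simp
           map_smul' := fun c φ => by
            ext i x
            exact congrArg (fun z => ((z i : T i) : W))
              ((e.restrictScalars k).map_smul c (φ x)) } : (P →ₗ[A] W) →ₗ[k] ∀ i, P →ₗ[A] T i)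
        ⟨fun φ ψ h => by
          ext x
          apply e.injective
          ext i
          simpa using congrArg (fun z => ((z i x : T i) : W)) h,
        fun ψ => ⟨e.symm.toLinearMap ∘ₗ LinearMap.pi ψ, by ext; simp⟩⟩
    rw [← hm P hP, e'.finrank_eq, Module.finrank_pi_fintype, Finset.card_filter]
    refine Finset.sum_congr rfl fun i _ => ?_
    rw [finrank_linearMap_of_isSimpleModule]
    exact if_congr (hiff i) rfl rfl
  have hf : Function.Surjective f := fun q => by
    have : (Finset.univ.filter fun i => f i = q).Nonempty := by
      rw [← Finset.card_pos, hfib]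
      exact Nat.pos_of_ne_zero hm0
    obtain ⟨i, hi⟩ := this
    exact ⟨i, (Finset.mem_filter.mp hi).2⟩
  have : Finite Q := Finite.of_surjective f hf
  have := Fintype.ofFinite Q
  have hn : n = Nat.card Q * m := by
    have h := Finset.card_eq_sum_card_fiberwise (f := f) (s := Finset.univ) (t := Finset.univ)
      (fun _ _ => by simp)
    simpa [hfib] using h
  rw [hdim]
  conv_rhs => rw [hn]
  ring

end Multiplicity

/-! ### Clifford theory -/

section Clifford

variable {A : Type*} [Ring A] [Algebra ℂ A] (α : G →* (A ≃ₐ[ℂ] A))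

/-- `X` and `Y` become isomorphic after twisting by one of the automorphisms `α g`. -/
def IsTwistOf (X Y : Type*) [AddCommGroup X] [Module ℂ X] [Module A X]
    [AddCommGroup Y] [Module ℂ Y] [Module A Y] : Prop :=
  ∃ (g : G) (e : X ≃ₗ[ℂ] Y), ∀ (a : A) (x : X), e (a • x) = α g a • e x

section Twist

variable {α} {X Y Z : Type*} [AddCommGroup X] [Module ℂ X] [Module A X]
  [AddCommGroup Y] [Module ℂ Y] [Module A Y] [AddCommGroup Z] [Module ℂ Z] [Module A Z]

theorem IsTwistOf.trans_linearEquiv [IsScalarTower ℂ A Y] [IsScalarTower ℂ A Z]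
    (h : IsTwistOf α X Y) (u : Y ≃ₗ[A] Z) : IsTwistOf α X Z := by
  obtain ⟨g, e, he⟩ := h
  exact ⟨g, e.trans (u.restrictScalars ℂ), fun a x => by simp [he]⟩

theorem IsTwistOf.linearEquiv_trans [IsScalarTower ℂ A X] [IsScalarTower ℂ A Y]
    (u : X ≃ₗ[A] Y) (h : IsTwistOf α Y Z) : IsTwistOf α X Z := by
  obtain ⟨g, e, he⟩ := h
  exact ⟨g, (u.restrictScalars ℂ).trans e, fun a x => by simp [he]⟩

theorem IsTwistOf.finrank_eq (h : IsTwistOf α X Y) : Module.finrank ℂ X = Module.finrank ℂ Y :=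
  h.choose_spec.choose.finrank_eq

theorem IsTwistOf.isSimpleModule (h : IsTwistOf α X Y) [IsSimpleModule A X] :
    IsSimpleModule A Y := by
  obtain ⟨g, e, he⟩ := h
  have := IsSimpleModule.nontrivial A X
  refine isSimpleModule_iff_toSpanSingleton_surjective.mpr
    ⟨e.symm.toEquiv.nontrivial, fun y hy z => ?_⟩
  obtain ⟨a, ha⟩ := IsSimpleModule.toSpanSingleton_surjective A
    (m := e.symm y) (by simpa using hy) (e.symm z)
  refine ⟨α g a, ?_⟩
  have := congrArg e ha
  simpa [he] using this

end Twist

variable {α} {V : Type*} [AddCommGroup V] [Module ℂ V] [Module A V]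
  {ρ : Representation ℂ G V} (hρ : ∀ g (a : A) v, ρ g (a • v) = α g a • ρ g v)

/-- The translate of a submodule by a group element, when `G` acts compatibly with `α`. -/
def conjTranslate (hρ : ∀ g (a : A) v, ρ g (a • v) = α g a • ρ g v) (g : G) (S : Submodule A V) :
    Submodule A V where
  carrier := {v | ρ g⁻¹ v ∈ S}
  add_mem' := fun hv hw => by simpa using S.add_mem hv hw
  zero_mem' := by simp
  smul_mem' := fun a v hv => by simpa [hρ] using S.smul_mem (α g⁻¹ a) hv

theorem mem_conjTranslate {g : G} {S : Submodule A V} {v : V} :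
    v ∈ conjTranslate hρ g S ↔ ρ g⁻¹ v ∈ S := Iff.rfl

variable [IsScalarTower ℂ A V]

/-- Homomorphism spaces into a module with a compatible `G`-action are invariant under twisting. -/
theorem IsTwistOf.finrank_linearMap_eq {X Y : Type*} [AddCommGroup X] [Module ℂ X] [Module A X]
    [IsScalarTower ℂ A X] [AddCommGroup Y] [Module ℂ Y] [Module A Y] [IsScalarTower ℂ A Y]
    (hρ : ∀ g (a : A) v, ρ g (a • v) = α g a • ρ g v) (h : IsTwistOf α X Y) :
    Module.finrank ℂ (X →ₗ[A] V) = Module.finrank ℂ (Y →ₗ[A] V) := by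
  obtain ⟨g, e, he⟩ := h
  have he' (a : A) (y : Y) : e.symm (a • y) = α g⁻¹ a • e.symm y := by
    apply e.injective
    simp [he]
  exact LinearEquiv.finrank_eq
    { toFun := fun f =>
        { toFun := fun y => ρ g (f (e.symm y))
          map_add' := by simp
          map_smul' := fun a y => by simp [he', hρ] }
      invFun := fun f =>
        { toFun := fun x => ρ g⁻¹ (f (e x))
          map_add' := by simp
          map_smul' := fun a y => by simp [he, hρ] }
      map_add' := fun f f' => by ext; simp
      map_smul' := fun c f => by ext; simp
      left_inv := fun f => by ext; simp
      right_inv := fun f => by ext; simp }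

/-- `ρ g` identifies a submodule with its translate, up to the twist by `α g`. -/
theorem exists_linearEquiv_conjTranslate (g : G) (S : Submodule A V) :
    ∃ e : S ≃ₗ[ℂ] conjTranslate hρ g S, ∀ (a : A) x, e (a • x) = α g a • e x :=
  ⟨{ toFun := fun v => ⟨ρ g v, by simp [mem_conjTranslate]⟩
     invFun := fun v => ⟨ρ g⁻¹ v, v.2⟩
     map_add' := fun v w => by ext; simp
     map_smul' := fun c v => by ext; simp
     left_inv := fun v => by ext; simp
     right_inv := fun v => by ext; simp },
    fun a x => by ext; simp [hρ]⟩

theorem isTwistOf_conjTranslate (g : G) (S : Submodule A V) : IsTwistOf α S (conjTranslate hρ g S) :=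
  ⟨g, exists_linearEquiv_conjTranslate hρ g S⟩

theorem iSup_conjTranslate_eq_top (hirr : IsIrrep ρ) {S : Submodule A V} (hS : S ≠ ⊥) :
    ⨆ g, conjTranslate hρ g S = ⊤ := by
  have hinv (g : G) (v : V) (hv : v ∈ ⨆ g, conjTranslate hρ g S) :
      ρ g v ∈ ⨆ g, conjTranslate hρ g S := by
    induction hv using Submodule.iSup_induction' with
    | mem h x hx =>
      refine Submodule.mem_iSup_of_mem (g * h) ?_
      rw [mem_conjTranslate] at hx ⊢
      simpa [← Module.End.mul_apply, ← map_mul] using hx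
    | zero => simp
    | add x y _ _ hx hy => simpa using add_mem hx hy
  rcases hirr.2 ((⨆ g, conjTranslate hρ g S).restrictScalars ℂ) hinv with h | h
  · rw [Submodule.restrictScalars_eq_bot_iff, iSup_eq_bot] at h
    refine absurd ?_ hS
    rw [eq_bot_iff, ← h 1]
    intro v hv
    simpa [mem_conjTranslate] using hv
  · rwa [Submodule.restrictScalars_eq_top_iff] at h

theorem isSemisimpleModule_of_isIrrep (hρ : ∀ g (a : A) v, ρ g (a • v) = α g a • ρ g v)
    (hirr : IsIrrep ρ) (S : Submodule A V) [hS : IsSimpleModule A S] : IsSemisimpleModule A V := by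
  refine isSemisimpleModule_of_isSemisimpleModule_submodule' (p := fun g => conjTranslate hρ g S)
    (fun g => ?_) (iSup_conjTranslate_eq_top hρ hirr ?_)
  · have := (isTwistOf_conjTranslate hρ g S).isSimpleModule
    infer_instance
  · exact (Submodule.nontrivial_iff_ne_bot).mp (IsSimpleModule.nontrivial A S)

/-- **Clifford's theorem**: simple submodules of an irreducible representation are conjugate. -/
theorem isTwistOf_of_isIrrep (hρ : ∀ g (a : A) v, ρ g (a • v) = α g a • ρ g v)
    (hirr : IsIrrep ρ) (S T : Submodule A V) [IsSimpleModule A S] [IsSimpleModule A T] :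
    IsTwistOf α S T := by
  have := isSemisimpleModule_of_isIrrep hρ hirr S
  obtain ⟨p, hp⟩ := IsSemisimpleModule.extension_property T.subtype T.injective_subtype
    LinearMap.id
  have hS : S ≠ ⊥ := (Submodule.nontrivial_iff_ne_bot).mp (IsSimpleModule.nontrivial A S)
  have hex : ∃ g, p ∘ₗ (conjTranslate hρ g S).subtype ≠ 0 := by
    by_contra! hzero
    have hle : ⊤ ≤ LinearMap.ker p := by
      rw [← iSup_conjTranslate_eq_top hρ hirr hS, iSup_le_iff]
      exact fun g v hv => LinearMap.congr_fun (hzero g) ⟨v, hv⟩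
    have := IsSimpleModule.nontrivial A T
    obtain ⟨t, ht⟩ := exists_ne (0 : T)
    refine ht ?_
    rw [← LinearMap.id_apply (R := A) t, ← hp]
    exact hle (Submodule.mem_top (x := (t : V)))
  obtain ⟨g, hg⟩ := hex
  have := (isTwistOf_conjTranslate hρ g S).isSimpleModule
  exact (isTwistOf_conjTranslate hρ g S).trans_linearEquiv
    (.ofBijective _ (LinearMap.bijective_of_ne_zero hg))

/-- A twist of a submodule is isomorphic to one of its translates. -/
theorem IsTwistOf.exists_conjTranslate_linearEquiv {S : Submodule A V} {Y : Type*} [AddCommGroup Y]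
    [Module ℂ Y] [Module A Y] (h : IsTwistOf α S Y) :
    ∃ g, Nonempty (conjTranslate hρ g S ≃ₗ[A] Y) := by
  obtain ⟨g, e, he⟩ := h
  obtain ⟨u, hu⟩ := exists_linearEquiv_conjTranslate hρ g S
  refine ⟨g, ⟨{ (u.symm.trans e) with map_smul' := fun a x => ?_ }⟩⟩
  obtain ⟨y, rfl⟩ := u.surjective x
  obtain ⟨b, rfl⟩ := (α g).surjective a
  simp [← hu, he]

variable {W : Type*} [AddCommGroup W] [Module ℂ W] [Module A W] [IsScalarTower ℂ A W]
  {τ : Representation ℂ G W}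

/-- The dimension formula for modules over an algebra on which `G` acts by automorphisms. -/
theorem card_classes_mul_finrank_linearMap [FiniteDimensional ℂ V] [FiniteDimensional ℂ W]
    (hρ : ∀ g (a : A) v, ρ g (a • v) = α g a • ρ g v)
    (hτ : ∀ g (a : A) w, τ g (a • w) = α g a • τ g w)
    (hirr : IsIrrep ρ) (hirr' : IsIrrep τ) {f : V →ₗ[A] W} (hf : f ≠ 0)
    (S : Submodule A V) [hS : IsSimpleModule A S] {Q : Type*}
    (cls : {S : Submodule A V // IsSimpleModule A S} → Q) (hsurj : Function.Surjective cls)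
    (hcls : ∀ S S', cls S = cls S' ↔ Nonempty (S.1 ≃ₗ[A] S'.1)) :
    Nat.card Q * Module.finrank ℂ S ^ 2 * Module.finrank ℂ (V →ₗ[A] W) =
      Module.finrank ℂ V * Module.finrank ℂ W := by
  have := isSemisimpleModule_of_isIrrep hρ hirr S
  obtain ⟨P, hP : IsSimpleModule A P, hfP⟩ := LinearMap.exists_ne_zero_of_sSup_eq_top hf _
    (IsSemisimpleModule.sSup_simples_eq_top A V)
  have u : P ≃ₗ[A] LinearMap.range (f.domRestrict P) :=
    .ofInjective _ (LinearMap.injective_of_ne_zero hfP)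
  have := IsSimpleModule.congr u.symm
  have := isSemisimpleModule_of_isIrrep hτ hirr' (LinearMap.range (f.domRestrict P))
  have : Module.Finite ℂ P := inferInstanceAs (Module.Finite ℂ (P.restrictScalars ℂ))
  have : Module.Finite ℂ (P →ₗ[A] W) := finite_linearMap_of_isScalarTower
  have hm0 : Module.finrank ℂ (P →ₗ[A] W) ≠ 0 := fun h =>
    hfP (Module.finrank_zero_iff.mp h |>.elim _ _)
  have hd (T : Submodule A V) (_ : IsSimpleModule A T) :
      Module.finrank ℂ T = Module.finrank ℂ S :=
    (isTwistOf_of_isIrrep hρ hirr T S).finrank_eq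
  have hm (T : Submodule A V) (_ : IsSimpleModule A T) :
      Module.finrank ℂ (T →ₗ[A] W) = Module.finrank ℂ (P →ₗ[A] W) :=
    (isTwistOf_of_isIrrep hρ hirr T P).finrank_linearMap_eq hτ
  have hW (T : Submodule A W) (_ : IsSimpleModule A T) :
      ∃ S : Submodule A V, IsSimpleModule A S ∧ Nonempty (S ≃ₗ[A] T) := by
    have h := isTwistOf_of_isIrrep hτ hirr' (LinearMap.range (f.domRestrict P)) T
    obtain ⟨g, hg⟩ := (h.linearEquiv_trans u).exists_conjTranslate_linearEquiv hρ
    exact ⟨_, (isTwistOf_conjTranslate hρ g P).isSimpleModule, hg⟩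
  have h1 := mul_finrank_linearMap_eq hd hm
  have h2 := card_classes_mul_eq_finrank cls hsurj hcls hd hm hm0 hW
  calc _ = Nat.card Q * Module.finrank ℂ S *
        (Module.finrank ℂ S * Module.finrank ℂ (V →ₗ[A] W)) := by ring
    _ = _ := by rw [h1, ← h2]; ring

end Clifford

/-! ### Restriction to a normal subgroup as modules over its group algebra -/

section GroupAlgebra

variable {N : Subgroup G} {V : Type*} [AddCommGroup V] [Module ℂ V] [Module (MonoidAlgebra ℂ N) V]
  [IsScalarTower ℂ (MonoidAlgebra ℂ N) V] {ρ : Representation ℂ G V}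
  {W : Type*} [AddCommGroup W] [Module ℂ W] [Module (MonoidAlgebra ℂ N) W]
  [IsScalarTower ℂ (MonoidAlgebra ℂ N) W] {τ : Representation ℂ G W}

theorem map_smul_of_map_single_smul (β : MonoidAlgebra ℂ N ≃ₐ[ℂ] MonoidAlgebra ℂ N)
    (f : V →ₗ[ℂ] W)
    (hf : ∀ (n : N) v, f (MonoidAlgebra.single n (1 : ℂ) • v) =
      β (MonoidAlgebra.single n (1 : ℂ)) • f v)
    (a : MonoidAlgebra ℂ N) (v : V) : f (a • v) = β a • f v := by
  induction a using MonoidAlgebra.induction_on with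
  | of n => exact hf n v
  | add a b ha hb => simp [add_smul, ha, hb]
  | smul c a ha => simp [ha]

theorem map_smul_domCongrAut_conjNormal [N.Normal]
    (hρ : ∀ (n : N) v, MonoidAlgebra.single n (1 : ℂ) • v = ρ n v)
    (g : G) (a : MonoidAlgebra ℂ N) (v : V) :
    ρ g (a • v) =
      ((MonoidAlgebra.domCongrAut (R := ℂ) (A := ℂ)).comp MulAut.conjNormal) g a • ρ g v := by
  refine map_smul_of_map_single_smul _ (ρ g) (fun n v => ?_) a v
  simp [MonoidAlgebra.domCongrAut, hρ]

theorem smul_mem_of_invariant (hρ : ∀ (n : N) v, MonoidAlgebra.single n (1 : ℂ) • v = ρ n v)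
    {p : Submodule ℂ V} (hp : ∀ n ∈ N, ∀ v ∈ p, ρ n v ∈ p) (a : MonoidAlgebra ℂ N) {v : V}
    (hv : v ∈ p) : a • v ∈ p := by
  induction a using MonoidAlgebra.induction_on with
  | of n => simpa [hρ] using hp n n.2 v hv
  | add a b ha hb => simpa [add_smul] using add_mem ha hb
  | smul c a ha => simpa using p.smul_mem c ha

theorem exists_restrictScalars_eq (hρ : ∀ (n : N) v, MonoidAlgebra.single n (1 : ℂ) • v = ρ n v)
    {p : Submodule ℂ V} (hp : ∀ n ∈ N, ∀ v ∈ p, ρ n v ∈ p) :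
    ∃ S : Submodule (MonoidAlgebra ℂ N) V, S.restrictScalars ℂ = p :=
  ⟨{ p with smul_mem' := fun a _ hv => smul_mem_of_invariant hρ hp a hv }, rfl⟩

theorem invariant_restrictScalars
    (hρ : ∀ (n : N) v, MonoidAlgebra.single n (1 : ℂ) • v = ρ n v)
    (S : Submodule (MonoidAlgebra ℂ N) V) :
    ∀ n ∈ N, ∀ v ∈ S.restrictScalars ℂ, ρ n v ∈ S.restrictScalars ℂ := fun n hn v hv => by
  rw [← hρ ⟨n, hn⟩]
  exact S.smul_mem _ hv

theorem isIrredSub_restrictScalars_iff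
    (hρ : ∀ (n : N) v, MonoidAlgebra.single n (1 : ℂ) • v = ρ n v)
    (S : Submodule (MonoidAlgebra ℂ N) V) :
    IsIrredSub N ρ (S.restrictScalars ℂ) ↔ IsSimpleModule (MonoidAlgebra ℂ N) S := by
  rw [isSimpleModule_iff_isAtom]
  constructor
  · rintro ⟨hne, -, h⟩
    refine ⟨by simpa using hne, fun T hT => ?_⟩
    rcases h (T.restrictScalars ℂ) hT.le (invariant_restrictScalars hρ T) with h | h
    · simpa using h
    · exact absurd (Submodule.restrictScalars_injective _ _ _ h) hT.ne
  · intro h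
    refine ⟨by simpa using h.1, invariant_restrictScalars hρ S, fun q hq hqinv => ?_⟩
    obtain ⟨T, rfl⟩ := exists_restrictScalars_eq hρ hqinv
    rcases h.le_iff.mp (show T ≤ S from hq) with rfl | rfl <;> simp

theorem subRepIso_restrictScalars_iff
    (hρ : ∀ (n : N) v, MonoidAlgebra.single n (1 : ℂ) • v = ρ n v)
    (S T : Submodule (MonoidAlgebra ℂ N) V) :
    SubRepIso N ρ ρ (S.restrictScalars ℂ) (T.restrictScalars ℂ) ↔
      Nonempty (S ≃ₗ[MonoidAlgebra ℂ N] T) := by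
  constructor
  · rintro ⟨e, he⟩
    let e' : S ≃ₗ[ℂ] T := e
    refine ⟨{ e' with map_smul' := map_smul_of_map_single_smul .refl e'.toLinearMap ?_ }⟩
    intro n v
    ext
    exact ((hρ n _).trans (he n n.2 v (MonoidAlgebra.single n (1 : ℂ) • v) (hρ n v).symm)).symm
  · rintro ⟨e⟩
    refine ⟨e.restrictScalars ℂ, fun n hn v w h => ?_⟩
    have hw : w = MonoidAlgebra.single (⟨n, hn⟩ : N) (1 : ℂ) • (show S from v) := by
      ext
      exact h.symm.trans (hρ ⟨n, hn⟩ v).symm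
    rw [← hρ ⟨n, hn⟩, hw]
    exact congrArg Subtype.val (e.map_smul _ _).symm

/-- Intertwining maps for `N` are the linear maps over the group algebra of `N`. -/
noncomputable def homSpaceEquiv (hρ : ∀ (n : N) v, MonoidAlgebra.single n (1 : ℂ) • v = ρ n v)
    (hτ : ∀ (n : N) w, MonoidAlgebra.single n (1 : ℂ) • w = τ n w) :
    homSpace N ρ τ ≃ₗ[ℂ] (V →ₗ[MonoidAlgebra ℂ N] W) where
  toFun f := { f.1 with
    map_smul' := map_smul_of_map_single_smul .refl f.1 fun n v => by
      rw [hρ, f.2 n n.2]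
      exact (hτ n _).symm }
  invFun f := ⟨f.restrictScalars ℂ, fun n hn v => by
    simpa [hρ, hτ] using f.map_smul (MonoidAlgebra.single (⟨n, hn⟩ : N) (1 : ℂ)) v⟩
  map_add' _ _ := rfl
  map_smul' _ _ := rfl
  left_inv _ := rfl
  right_inv _ := rfl

/-- The dimension formula, for representations given as modules over the group algebra of `N`. -/
theorem numIrredClasses_mul_finrank_homSpace [N.Normal]
    [FiniteDimensional ℂ V] [FiniteDimensional ℂ W]
    (hρ : ∀ (n : N) v, MonoidAlgebra.single n (1 : ℂ) • v = ρ n v)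
    (hτ : ∀ (n : N) w, MonoidAlgebra.single n (1 : ℂ) • w = τ n w)
    (hirr : IsIrrep ρ) (hirr' : IsIrrep τ) (hne : homSpace N ρ τ ≠ ⊥)
    (σ : Submodule ℂ V) (hσ : IsIrredSub N ρ σ) :
    numIrredClasses N ρ * Module.finrank ℂ σ ^ 2 * Module.finrank ℂ (homSpace N ρ τ) =
      Module.finrank ℂ V * Module.finrank ℂ W := by
  obtain ⟨f, hf, hf0⟩ := Submodule.exists_mem_ne_zero_of_ne_bot hne
  obtain ⟨S, rfl⟩ := exists_restrictScalars_eq hρ hσ.2.1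
  have := (isIrredSub_restrictScalars_iff hρ S).mp hσ
  have hequiv : Equivalence (fun p q : {p : Submodule ℂ V // IsIrredSub N ρ p} =>
      SubRepIso N ρ ρ p.1 q.1) := by
    refine ⟨fun ⟨p, hp⟩ => ?_, @fun ⟨p, hp⟩ ⟨q, hq⟩ h => ?_, @fun ⟨p, hp⟩ ⟨q, hq⟩ ⟨r, hr⟩ h h' => ?_⟩
    · obtain ⟨P, rfl⟩ := exists_restrictScalars_eq hρ hp.2.1
      exact (subRepIso_restrictScalars_iff hρ P P).mpr ⟨.refl _ _⟩
    · obtain ⟨P, rfl⟩ := exists_restrictScalars_eq hρ hp.2.1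
      obtain ⟨Q, rfl⟩ := exists_restrictScalars_eq hρ hq.2.1
      obtain ⟨e⟩ := (subRepIso_restrictScalars_iff hρ P Q).mp h
      exact (subRepIso_restrictScalars_iff hρ Q P).mpr ⟨e.symm⟩
    · obtain ⟨P, rfl⟩ := exists_restrictScalars_eq hρ hp.2.1
      obtain ⟨Q, rfl⟩ := exists_restrictScalars_eq hρ hq.2.1
      obtain ⟨R, rfl⟩ := exists_restrictScalars_eq hρ hr.2.1
      obtain ⟨e⟩ := (subRepIso_restrictScalars_iff hρ P Q).mp h
      obtain ⟨e'⟩ := (subRepIso_restrictScalars_iff hρ Q R).mp h'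
      exact (subRepIso_restrictScalars_iff hρ P R).mpr ⟨e.trans e'⟩
  have hf' : homSpaceEquiv hρ hτ ⟨f, hf⟩ ≠ 0 := by
    rw [Ne, LinearEquiv.map_eq_zero_iff]
    simpa using hf0
  rw [(homSpaceEquiv hρ hτ).finrank_eq]
  refine card_classes_mul_finrank_linearMap (map_smul_domCongrAut_conjNormal hρ)
    (map_smul_domCongrAut_conjNormal hτ) hirr hirr' hf' S
    (fun P => Quot.mk _ ⟨P.1.restrictScalars ℂ, (isIrredSub_restrictScalars_iff hρ P.1).mpr P.2⟩)
    ?_ fun P Q => ?_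
  · rintro ⟨p, hp⟩
    obtain ⟨P, rfl⟩ := exists_restrictScalars_eq hρ hp.2.1
    exact ⟨⟨P, (isIrredSub_restrictScalars_iff hρ P).mp hp⟩, rfl⟩
  · rw [hequiv.quot_mk_eq_iff]
    exact subRepIso_restrictScalars_iff hρ P.1 Q.1

end GroupAlgebra

/-- `k · d_σ² · dim Hom_N(π₁, π₂) = d_{π₁} · d_{π₂}`. -/
theorem stmt6 {V₁ V₂ : Type*} [AddCommGroup V₁] [Module ℂ V₁] [FiniteDimensional ℂ V₁]
    [AddCommGroup V₂] [Module ℂ V₂] [FiniteDimensional ℂ V₂]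
    (N : Subgroup G) [N.Normal]
    (ρ₁ : Representation ℂ G V₁) (ρ₂ : Representation ℂ G V₂)
    (h₁ : IsIrrep ρ₁) (h₂ : IsIrrep ρ₂)
    (hne : homSpace N ρ₁ ρ₂ ≠ ⊥)
    (σ : Submodule ℂ V₁) (hσ : IsIrredSub N ρ₁ σ) :
    numIrredClasses N ρ₁ * Module.finrank ℂ σ ^ 2 * Module.finrank ℂ (homSpace N ρ₁ ρ₂) =
      Module.finrank ℂ V₁ * Module.finrank ℂ V₂ := by
  let _ : Module (MonoidAlgebra ℂ N) V₁ :=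
    Module.compHom V₁ (Representation.asAlgebraHom (ρ₁.comp N.subtype)).toRingHom
  let _ : Module (MonoidAlgebra ℂ N) V₂ :=
    Module.compHom V₂ (Representation.asAlgebraHom (ρ₂.comp N.subtype)).toRingHom
  have smul₁ (a : MonoidAlgebra ℂ N) (v : V₁) :
      a • v = Representation.asAlgebraHom (ρ₁.comp N.subtype) a v := rfl
  have smul₂ (a : MonoidAlgebra ℂ N) (v : V₂) :
      a • v = Representation.asAlgebraHom (ρ₂.comp N.subtype) a v := rfl
  have : IsScalarTower ℂ (MonoidAlgebra ℂ N) V₁ := ⟨fun c a v => by simp [smul₁]⟩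
  have : IsScalarTower ℂ (MonoidAlgebra ℂ N) V₂ := ⟨fun c a v => by simp [smul₂]⟩
  exact numIrredClasses_mul_finrank_homSpace (fun n v => by simp [smul₁])
    (fun n v => by simp [smul₂]) h₁ h₂ hne σ hσ
end

section
/- Let G be a group, (U_m)_{m≥0} a decreasing sequence of normal subgroups of G, and w : ℕ → [0, ∞] a family of weights. For irreducible finite-dimensional complex representations π, π' of G set inv(π, π') := Σ_{m=1}^∞ w_m · dim Hom_{U_m}(π, π') ∈ [0, ∞]. Then for any three irreducible finite-dimensional complex representations π₁, π₂, π₃ of G, one has inv(π₁, π₃)/(d_{π₁} d_{π₃}) ≥ min( inv(π₁, π₂)/(d_{π₁} d_{π₂}), inv(π₂, π₃)/(d_{π₂} d_{π₃}) ), as an inequality in [0, ∞]. -/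
variable {G : Type*} [Group G]

open scoped ENNReal

/-- `inv(π, π') = Σ_{m=1}^∞ w_m · dim Hom_{U_m}(π, π')`, a sum in `[0, ∞]`. -/
noncomputable def invW (U : ℕ → Subgroup G) (w : ℕ → ℝ≥0∞) {V₁ V₂ : Type*}
    [AddCommGroup V₁] [Module ℂ V₁] [AddCommGroup V₂] [Module ℂ V₂]
    (ρ₁ : Representation ℂ G V₁) (ρ₂ : Representation ℂ G V₂) : ℝ≥0∞ :=
  ∑' m : ℕ, w (m + 1) * (Module.finrank ℂ (homSpace (U (m + 1)) ρ₁ ρ₂) : ℝ≥0∞)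

section Clifford

variable {V W S : Type*} [AddCommGroup V] [Module ℂ V] [AddCommGroup W] [Module ℂ W]
  [AddCommGroup S] [Module ℂ S]

theorem homSpace_anti {H K : Subgroup G} (hHK : H ≤ K) (ρ : Representation ℂ G V)
    (ρ' : Representation ℂ G W) : homSpace K ρ ρ' ≤ homSpace H ρ ρ' :=
  fun _ hf h hh v => hf h (hHK hh) v

/-- The restriction of a representation to a subgroup. -/
abbrev resSubgroup (N : Subgroup G) (ρ : Representation ℂ G V) : Representation ℂ N V :=
  ρ.comp N.subtype

/-- The map `(sᵢ) ↦ ∑ ρ(gᵢ) (j sᵢ)`. -/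
noncomputable def translateSum (ρ : Representation ℂ G V) (j : S →ₗ[ℂ] V) {n : ℕ}
    (g : Fin n → G) : (Fin n → S) →ₗ[ℂ] V :=
  ∑ i, ρ (g i) ∘ₗ j ∘ₗ LinearMap.proj i

theorem translateSum_apply (ρ : Representation ℂ G V) (j : S →ₗ[ℂ] V) {n : ℕ}
    (g : Fin n → G) (s : Fin n → S) : translateSum ρ j g s = ∑ i, ρ (g i) (j (s i)) := by
  simp [translateSum]

/-- A normal subgroup acts on translates by conjugated elements. -/
theorem apply_translate {N : Subgroup G} (hN : N.Normal) {ρ : Representation ℂ G V}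
    {τ : Representation ℂ N S} {j : S →ₗ[ℂ] V} (hj : j ∈ homSpace ⊤ τ (resSubgroup N ρ))
    (g : G) (u : N) (s : S) :
    ρ u (ρ g (j s)) = ρ g (j (τ ⟨g⁻¹ * u * g, by
      simpa using hN.conj_mem u u.2 g⁻¹⟩ s)) := by
  rw [hj _ trivial]
  simp only [MonoidHom.comp_apply, Subgroup.coe_subtype, ← Module.End.mul_apply, ← map_mul]
  congr 2
  group

theorem apply_translateSum {N : Subgroup G} (hN : N.Normal) {ρ : Representation ℂ G V}
    {τ : Representation ℂ N S} {j : S →ₗ[ℂ] V} (hj : j ∈ homSpace ⊤ τ (resSubgroup N ρ))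
    {n : ℕ} (g : Fin n → G) (u : N) (s : Fin n → S) :
    ρ u (translateSum ρ j g s) = translateSum ρ j g (fun i => τ ⟨(g i)⁻¹ * u * g i, by
      simpa using hN.conj_mem u u.2 (g i)⁻¹⟩ (s i)) := by
  simp only [translateSum_apply, map_sum]
  exact Finset.sum_congr rfl fun i _ => apply_translate hN hj (g i) u (s i)

theorem iSup_translates_eq_top {ρ : Representation ℂ G V} (hρ : IsIrrep ρ) {j : S →ₗ[ℂ] V}
    (hj : j ≠ 0) : ⨆ g : G, LinearMap.range (ρ g ∘ₗ j) = ⊤ := by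
  refine (hρ.2 _ fun g v hv => ?_).resolve_left fun h => hj ?_
  · have hle : ⨆ g : G, LinearMap.range (ρ g ∘ₗ j) ≤
        (⨆ g : G, LinearMap.range (ρ g ∘ₗ j)).comap (ρ g) := by
      refine iSup_le fun k => ?_
      rintro _ ⟨s, rfl⟩
      exact Submodule.mem_iSup_of_mem (g * k) ⟨s, by simp⟩
    exact hle hv
  · ext s
    have hs : j s ∈ ⨆ g : G, LinearMap.range (ρ g ∘ₗ j) :=
      Submodule.mem_iSup_of_mem 1 ⟨s, by simp⟩
    simpa [h] using hs

/-- Clifford decomposition: an irreducible representation of `G` containing an irreducible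
representation `S` of a normal subgroup is a direct sum of translates of `S`. -/
theorem exists_bijective_translateSum [FiniteDimensional ℂ V] [FiniteDimensional ℂ S]
    {N : Subgroup G} (hN : N.Normal)
    {ρ : Representation ℂ G V} (hρ : IsIrrep ρ) {τ : Representation ℂ N S} (hτ : IsIrrep τ)
    {j : S →ₗ[ℂ] V} (hj : j ∈ homSpace ⊤ τ (resSubgroup N ρ)) (hj0 : j ≠ 0) :
    ∃ (n : ℕ) (g : Fin n → G), Function.Bijective (translateSum ρ j g) := by
  classical
  let P : ℕ → Prop := fun n => ∃ g : Fin n → G, Function.Injective (translateSum ρ j g)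
  have hS : 0 < Module.finrank ℂ S := by
    have := hτ.1
    exact Module.finrank_pos
  have hbound : ∀ n, P n → n ≤ Module.finrank ℂ V := by
    rintro n ⟨g, hg⟩
    have h := LinearMap.finrank_le_finrank_of_injective hg
    rw [Module.finrank_pi_fintype] at h
    simp only [Finset.sum_const, Finset.card_univ, Fintype.card_fin, smul_eq_mul] at h
    exact (Nat.le_mul_of_pos_right n hS).trans h
  have h0 : P 0 := ⟨Fin.elim0, Function.injective_of_subsingleton _⟩
  obtain ⟨g, hg⟩ : P (Nat.findGreatest P (Module.finrank ℂ V)) :=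
    Nat.findGreatest_spec (Nat.zero_le _) h0
  refine ⟨_, g, hg, LinearMap.range_eq_top.mp (top_le_iff.mp ?_)⟩
  rw [← iSup_translates_eq_top hρ hj0]
  refine iSup_le fun k => ?_
  have hstable := hτ.2 ((LinearMap.range (translateSum ρ j g)).comap (ρ k ∘ₗ j)) (by
    rintro u s ⟨t, ht⟩
    have hu : k * u * k⁻¹ ∈ N := hN.conj_mem u u.2 k
    have h := apply_translate hN hj k ⟨_, hu⟩ s
    have h' := apply_translateSum hN hj g ⟨_, hu⟩ t
    simp only [mul_assoc, inv_mul_cancel_left, inv_mul_cancel, mul_one] at h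
    refine ⟨_, h'.symm.trans ?_⟩
    rw [ht]
    simpa [mul_assoc] using h)
  rcases hstable with h | h
  · exfalso
    refine absurd (Nat.le_findGreatest (hbound _ ?_) ?_) (Nat.not_succ_le_self
      (Nat.findGreatest P (Module.finrank ℂ V)))
    all_goals
      refine ⟨Fin.cons k g, (injective_iff_map_eq_zero _).mpr fun s hs => ?_⟩
      have hs' : ρ k (j (s 0)) + translateSum ρ j g (Fin.tail s) = 0 := by
        rw [translateSum_apply, Fin.sum_univ_succ] at hs
        simpa [translateSum_apply, Fin.tail] using hs
      have hs0 : s 0 = 0 := by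
        rw [← Submodule.mem_bot ℂ, ← h]
        exact ⟨-Fin.tail s, by rw [map_neg]; exact (eq_neg_of_add_eq_zero_left hs').symm⟩
      have ht : Fin.tail s = 0 := by
        apply hg
        simpa [hs0] using hs'
      ext i
      refine Fin.cases hs0 (fun i => congrFun ht i) i
  · rintro _ ⟨s, rfl⟩
    have : s ∈ (LinearMap.range (translateSum ρ j g)).comap (ρ k ∘ₗ j) := h ▸ trivial
    exact this

/-- Conjugating an `N`-equivariant map by an element of `G`. -/
theorem conj_mem_homSpace {N : Subgroup G} (hN : N.Normal) {ρ : Representation ℂ G V}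
    {ρ' : Representation ℂ G W} {f : V →ₗ[ℂ] W} (hf : f ∈ homSpace N ρ ρ') (g : G) :
    ρ' g⁻¹ ∘ₗ f ∘ₗ ρ g ∈ homSpace N ρ ρ' := by
  intro u hu v
  have h := hf _ (hN.conj_mem u hu g) (ρ g v)
  simp only [LinearMap.comp_apply]
  rw [← Module.End.mul_apply, ← map_mul, inv_mul_cancel_right, map_mul, Module.End.mul_apply] at h
  rw [h, ← Module.End.mul_apply, ← Module.End.mul_apply, ← map_mul, ← map_mul]
  congr 2
  group

theorem comp_mem_homSpace {N : Subgroup G} {ρ : Representation ℂ G V}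
    {ρ' : Representation ℂ G W} {τ : Representation ℂ N S} {f : V →ₗ[ℂ] W}
    (hf : f ∈ homSpace N ρ ρ') {j : S →ₗ[ℂ] V} (hj : j ∈ homSpace ⊤ τ (resSubgroup N ρ)) :
    f ∘ₗ j ∈ homSpace ⊤ τ (resSubgroup N ρ') := fun u _ s =>
  (congrArg f (hj u trivial s)).trans (hf u u.2 (j s))

theorem finrank_of_bijective_translateSum [FiniteDimensional ℂ S]
    {ρ : Representation ℂ G V} {j : S →ₗ[ℂ] V} {n : ℕ} {g : Fin n → G}
    (hg : Function.Bijective (translateSum ρ j g)) :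
    Module.finrank ℂ V = n * Module.finrank ℂ S := by
  rw [← (LinearEquiv.ofBijective _ hg).finrank_eq, Module.finrank_pi_fintype]
  simp

theorem finrank_homSpace_left [FiniteDimensional ℂ W] [FiniteDimensional ℂ S]
    {N : Subgroup G} (hN : N.Normal) {ρ : Representation ℂ G V} {ρ' : Representation ℂ G W}
    {τ : Representation ℂ N S} {j : S →ₗ[ℂ] V} (hj : j ∈ homSpace ⊤ τ (resSubgroup N ρ))
    {n : ℕ} {g : Fin n → G} (hg : Function.Bijective (translateSum ρ j g)) :
    Module.finrank ℂ (homSpace N ρ ρ') =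
      n * Module.finrank ℂ (homSpace ⊤ τ (resSubgroup N ρ')) := by
  let Φ : homSpace N ρ ρ' →ₗ[ℂ] (Fin n → homSpace ⊤ τ (resSubgroup N ρ')) :=
    { toFun := fun f i => ⟨(ρ' (g i)⁻¹ ∘ₗ f.1 ∘ₗ ρ (g i)) ∘ₗ j,
        comp_mem_homSpace (conj_mem_homSpace hN f.2 (g i)) hj⟩
      map_add' := fun f f' => by ext; simp
      map_smul' := fun c f => by ext; simp }
  have hΦ : Function.Bijective Φ := by
    constructor
    · refine (injective_iff_map_eq_zero _).mpr fun f hf => ?_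
      ext v
      obtain ⟨s, rfl⟩ := hg.2 v
      rw [translateSum_apply, map_sum]
      refine Finset.sum_eq_zero fun i _ => ?_
      have h : ρ' (g i)⁻¹ (f.1 (ρ (g i) (j (s i)))) = 0 :=
        LinearMap.congr_fun (congrArg Subtype.val (congrFun hf i)) (s i)
      simpa using congrArg (ρ' (g i)) h
    · intro F
      let e := LinearEquiv.ofBijective _ hg
      let f : V →ₗ[ℂ] W := (∑ i, ρ' (g i) ∘ₗ (F i).1 ∘ₗ LinearMap.proj i) ∘ₗ e.symm.toLinearMap
      have hf : ∀ s, f (translateSum ρ j g s) = ∑ i, ρ' (g i) ((F i).1 (s i)) := fun s => by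
        have : e.symm (translateSum ρ j g s) = s := e.symm_apply_apply s
        simp [f, this]
      refine ⟨⟨f, fun u hu v => ?_⟩, ?_⟩
      · obtain ⟨s, rfl⟩ := hg.2 v
        rw [apply_translateSum hN hj g ⟨u, hu⟩ s, hf, hf, map_sum]
        exact Finset.sum_congr rfl fun i _ => (apply_translate hN (F i).2 (g i) ⟨u, hu⟩ (s i)).symm
      · ext i s
        have h := hf (Pi.single i s)
        rw [translateSum_apply, Finset.sum_eq_single i (by
          intro k _ hk; simp [hk]) (by simp), Finset.sum_eq_single i (by
          intro k _ hk; simp [hk]) (by simp), Pi.single_eq_same] at h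
        simp [Φ, h]
  rw [(LinearEquiv.ofBijective Φ hΦ).finrank_eq, Module.finrank_pi_fintype]
  simp

theorem finrank_homSpace_right [FiniteDimensional ℂ W] [FiniteDimensional ℂ S]
    {N : Subgroup G} (hN : N.Normal) {ρ : Representation ℂ G V} {ρ' : Representation ℂ G W}
    {τ : Representation ℂ N S} {j : S →ₗ[ℂ] V} (hj : j ∈ homSpace ⊤ τ (resSubgroup N ρ))
    {n : ℕ} {g : Fin n → G} (hg : Function.Bijective (translateSum ρ j g)) :
    Module.finrank ℂ (homSpace N ρ' ρ) =
      n * Module.finrank ℂ (homSpace ⊤ (resSubgroup N ρ') τ) := by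
  let e := LinearEquiv.ofBijective _ hg
  have he : ∀ (u : N) (v : V) (i : Fin n), e.symm (ρ (g i * u * (g i)⁻¹) v) i =
      τ u (e.symm v i) := fun u v i => by
    obtain ⟨s, rfl⟩ := hg.2 v
    have hs : ∀ s, e.symm (translateSum ρ j g s) = s := fun s => e.symm_apply_apply s
    have h := apply_translateSum hN hj g ⟨_, hN.conj_mem u u.2 (g i)⟩ s
    dsimp only at h
    rw [h, hs, hs]
    simp [mul_assoc]
  let Φ : homSpace N ρ' ρ →ₗ[ℂ] (Fin n → homSpace ⊤ (resSubgroup N ρ') τ) :=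
    { toFun := fun f i => ⟨LinearMap.proj i ∘ₗ e.symm.toLinearMap ∘ₗ f.1 ∘ₗ ρ' (g i),
        fun u _ w => by
          have h := f.2 _ (hN.conj_mem u u.2 (g i)) (ρ' (g i) w)
          rw [← Module.End.mul_apply, ← map_mul, inv_mul_cancel_right, map_mul,
            Module.End.mul_apply] at h
          simpa [h] using he u (f.1 (ρ' (g i) w)) i⟩
      map_add' := fun f f' => by ext; simp
      map_smul' := fun c f => by ext; simp }
  have hΦ : Function.Bijective Φ := by
    constructor
    · refine (injective_iff_map_eq_zero _).mpr fun f hf => ?_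
      ext w
      apply e.symm.injective
      ext i
      have h : e.symm (f.1 (ρ' (g i) (ρ' (g i)⁻¹ w))) i = 0 :=
        LinearMap.congr_fun (congrArg Subtype.val (congrFun hf i)) (ρ' (g i)⁻¹ w)
      simpa using h
    · intro F
      let c : W →ₗ[ℂ] (Fin n → S) := LinearMap.pi fun i => (F i).1 ∘ₗ ρ' (g i)⁻¹
      refine ⟨⟨translateSum ρ j g ∘ₗ c, fun u hu w => ?_⟩, ?_⟩
      · rw [LinearMap.comp_apply, LinearMap.comp_apply, apply_translateSum hN hj g ⟨u, hu⟩]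
        congr 1
        ext i
        have hu' : (g i)⁻¹ * u * g i ∈ N := by simpa using hN.conj_mem u hu (g i)⁻¹
        have h := (F i).2 ⟨_, hu'⟩ trivial (ρ' (g i)⁻¹ w)
        simp only [c, LinearMap.pi_apply, LinearMap.comp_apply]
        rw [← h]
        simp only [MonoidHom.comp_apply, Subgroup.coe_subtype, ← Module.End.mul_apply, ← map_mul]
        congr 3
        group
      · ext i w
        have h : e.symm (translateSum ρ j g (c (ρ' (g i) w))) = c (ρ' (g i) w) :=
          e.symm_apply_apply _
        simp [Φ, h, c]
  rw [(LinearEquiv.ofBijective Φ hΦ).finrank_eq, Module.finrank_pi_fintype]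
  simp

/-- A nonzero finite-dimensional representation contains an irreducible one. -/
theorem exists_irreducible_subrepresentation [FiniteDimensional ℂ V] [Nontrivial V]
    (ρ : Representation ℂ G V) : ∃ (p : Submodule ℂ V) (τ : Representation ℂ G p),
      IsIrrep τ ∧ p.subtype ∈ homSpace ⊤ τ ρ := by
  obtain ⟨p, ⟨hp0, hp⟩, hmin⟩ := wellFounded_lt.has_min
    {p : Submodule ℂ V | p ≠ ⊥ ∧ ∀ g, ∀ v ∈ p, ρ g v ∈ p} ⟨⊤, top_ne_bot, by simp⟩
  let τ : Representation ℂ G p :=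
    { toFun := fun g => (ρ g).restrict (hp g)
      map_one' := by ext; simp
      map_mul' := fun g h => by ext; simp }
  refine ⟨p, τ, ⟨Submodule.nontrivial_iff_ne_bot.mpr hp0, fun q hq => ?_⟩, fun g _ v => rfl⟩
  by_contra! h
  refine hmin (q.map p.subtype) ⟨fun h0 => h.1 ?_, ?_⟩
    (lt_of_le_of_ne (Submodule.map_subtype_le p q) fun h1 => h.2 ?_)
  · exact Submodule.map_injective_of_injective p.subtype_injective (by simpa using h0)
  · rintro g _ ⟨v, hv, rfl⟩
    exact ⟨τ g v, hq g v hv, rfl⟩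
  · apply Submodule.map_injective_of_injective p.subtype_injective
    simpa using h1

/-- Irreducible representations of `G` with a nonzero `N`-equivariant map between them share an
irreducible representation of `N`, of which both are sums of translates. -/
theorem exists_common_constituent [FiniteDimensional ℂ V] [FiniteDimensional ℂ W]
    {N : Subgroup G} (hN : N.Normal) {ρ : Representation ℂ G V} {ρ' : Representation ℂ G W}
    (hρ : IsIrrep ρ) (hρ' : IsIrrep ρ') (h : homSpace N ρ ρ' ≠ ⊥) :
    ∃ (p : Submodule ℂ V) (τ : Representation ℂ N p) (j : p →ₗ[ℂ] V) (j' : p →ₗ[ℂ] W)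
      (n n' : ℕ) (g : Fin n → G) (g' : Fin n' → G),
      j ∈ homSpace ⊤ τ (resSubgroup N ρ) ∧ j' ∈ homSpace ⊤ τ (resSubgroup N ρ') ∧
      Function.Bijective (translateSum ρ j g) ∧ Function.Bijective (translateSum ρ' j' g') := by
  have := hρ.1
  obtain ⟨p, τ, hτ, hj⟩ := exists_irreducible_subrepresentation (resSubgroup N ρ)
  have hp0 : p.subtype ≠ 0 := fun h0 => by
    obtain ⟨v, hv⟩ := @exists_ne _ hτ.1 0
    exact hv (p.subtype_injective (by simp [h0]))
  obtain ⟨f, hf, hf0⟩ := (Submodule.ne_bot_iff _).mp h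
  obtain ⟨k, hk⟩ : ∃ k, (ρ' k⁻¹ ∘ₗ f ∘ₗ ρ k) ∘ₗ p.subtype ≠ 0 := by
    by_contra! hzero
    refine hf0 (LinearMap.ker_eq_top.mp (top_le_iff.mp ?_))
    rw [← iSup_translates_eq_top hρ hp0]
    refine iSup_le fun k => ?_
    rintro _ ⟨s, rfl⟩
    simpa using congrArg (ρ' k) (LinearMap.congr_fun (hzero k) s)
  have hj' := comp_mem_homSpace (conj_mem_homSpace hN hf k) hj
  obtain ⟨n, g, hg⟩ := exists_bijective_translateSum hN hρ hτ hj hp0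
  obtain ⟨n', g', hg'⟩ := exists_bijective_translateSum hN hρ' hτ hj' hk
  exact ⟨p, τ, _, _, n, n', g, g', hj, hj', hg, hg'⟩

variable {X : Type*} [AddCommGroup X] [Module ℂ X] [FiniteDimensional ℂ V]
  [FiniteDimensional ℂ W] [FiniteDimensional ℂ X] {N : Subgroup G} {ρ : Representation ℂ G V}
  {ρ' : Representation ℂ G W}

theorem finrank_homSpace_mul_comm_left (hN : N.Normal) (hρ : IsIrrep ρ) (hρ' : IsIrrep ρ')
    (h : homSpace N ρ ρ' ≠ ⊥) (θ : Representation ℂ G X) :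
    Module.finrank ℂ (homSpace N ρ' θ) * Module.finrank ℂ V =
      Module.finrank ℂ (homSpace N ρ θ) * Module.finrank ℂ W := by
  obtain ⟨p, τ, j, j', n, n', g, g', hj, hj', hg, hg'⟩ := exists_common_constituent hN hρ hρ' h
  rw [finrank_homSpace_left hN hj hg, finrank_homSpace_left hN hj' hg',
    finrank_of_bijective_translateSum hg, finrank_of_bijective_translateSum hg']
  ring

theorem finrank_homSpace_mul_comm_right (hN : N.Normal) (hρ : IsIrrep ρ) (hρ' : IsIrrep ρ')
    (h : homSpace N ρ ρ' ≠ ⊥) (θ : Representation ℂ G X) :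
    Module.finrank ℂ (homSpace N θ ρ) * Module.finrank ℂ W =
      Module.finrank ℂ (homSpace N θ ρ') * Module.finrank ℂ V := by
  obtain ⟨p, τ, j, j', n, n', g, g', hj, hj', hg, hg'⟩ := exists_common_constituent hN hρ hρ' h
  rw [finrank_homSpace_right hN hj hg, finrank_homSpace_right hN hj' hg',
    finrank_of_bijective_translateSum hg, finrank_of_bijective_translateSum hg']
  ring

end Clifford

/-- Termwise comparison of weighted sums of natural numbers, cross-multiplied by dimensions. -/
theorem ENNReal.tsum_weight_div_le {w : ℕ → ℝ≥0∞} {a b : ℕ → ℕ} {c d : ℕ} (hc : c ≠ 0)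
    (hd : d ≠ 0) (h : ∀ m, a m * d ≤ b m * c) :
    (∑' m, w m * (a m : ℝ≥0∞)) / c ≤ (∑' m, w m * (b m : ℝ≥0∞)) / d := by
  have hc' : (c : ℝ≥0∞) ≠ 0 := by exact_mod_cast hc
  have hd' : (d : ℝ≥0∞) ≠ 0 := by exact_mod_cast hd
  rw [ENNReal.div_le_iff hc' (ENNReal.natCast_ne_top c), ← ENNReal.mul_div_right_comm,
    ENNReal.le_div_iff_mul_le (Or.inl hd') (Or.inl (ENNReal.natCast_ne_top d)),
    ← ENNReal.tsum_mul_right, ← ENNReal.tsum_mul_right]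
  refine ENNReal.tsum_le_tsum fun m => ?_
  rw [mul_assoc, mul_assoc]
  exact mul_le_mul_right (by exact_mod_cast h m) _

/-- the ultrametric inequality
`inv(π₁,π₃)/(d₁d₃) ≥ min(inv(π₁,π₂)/(d₁d₂), inv(π₂,π₃)/(d₂d₃))` in `[0, ∞]`. -/
theorem stmt9 {V₁ V₂ V₃ : Type*} [AddCommGroup V₁] [Module ℂ V₁] [FiniteDimensional ℂ V₁]
    [AddCommGroup V₂] [Module ℂ V₂] [FiniteDimensional ℂ V₂]
    [AddCommGroup V₃] [Module ℂ V₃] [FiniteDimensional ℂ V₃]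
    (U : ℕ → Subgroup G) (hU : Antitone U) (hUnormal : ∀ m, (U m).Normal)
    (w : ℕ → ℝ≥0∞)
    (ρ₁ : Representation ℂ G V₁) (ρ₂ : Representation ℂ G V₂) (ρ₃ : Representation ℂ G V₃)
    (h₁ : IsIrrep ρ₁) (h₂ : IsIrrep ρ₂) (h₃ : IsIrrep ρ₃) :
    invW U w ρ₁ ρ₃ / ((Module.finrank ℂ V₁ : ℝ≥0∞) * (Module.finrank ℂ V₃ : ℝ≥0∞)) ≥
      min (invW U w ρ₁ ρ₂ / ((Module.finrank ℂ V₁ : ℝ≥0∞) * (Module.finrank ℂ V₂ : ℝ≥0∞)))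
        (invW U w ρ₂ ρ₃ / ((Module.finrank ℂ V₂ : ℝ≥0∞) * (Module.finrank ℂ V₃ : ℝ≥0∞))) := by
  have := h₁.1
  have := h₂.1
  have := h₃.1
  have hd₁ : Module.finrank ℂ V₁ ≠ 0 := Module.finrank_pos.ne'
  have hd₂ : Module.finrank ℂ V₂ ≠ 0 := Module.finrank_pos.ne'
  have hd₃ : Module.finrank ℂ V₃ ≠ 0 := Module.finrank_pos.ne'
  have hcases : (∀ m, homSpace (U m) ρ₁ ρ₂ ≠ ⊥ → homSpace (U m) ρ₂ ρ₃ ≠ ⊥) ∨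
      (∀ m, homSpace (U m) ρ₂ ρ₃ ≠ ⊥ → homSpace (U m) ρ₁ ρ₂ ≠ ⊥) := by
    by_contra! h
    obtain ⟨⟨m, hm, hm'⟩, k, hk, hk'⟩ := h
    rcases le_total m k with hmk | hkm
    · exact hm (le_bot_iff.mp (hk' ▸ homSpace_anti (hU hmk) ρ₁ ρ₂))
    · exact hk (le_bot_iff.mp (hm' ▸ homSpace_anti (hU hkm) ρ₂ ρ₃))
  simp only [← Nat.cast_mul]
  rcases hcases with h | h
  · refine (min_le_left _ _).trans
      (ENNReal.tsum_weight_div_le (mul_ne_zero hd₁ hd₂) (mul_ne_zero hd₁ hd₃) fun m => ?_)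
    by_cases hm : homSpace (U (m + 1)) ρ₁ ρ₂ = ⊥
    · rw [Submodule.finrank_eq_zero.mpr hm, zero_mul]
      exact Nat.zero_le _
    · have := finrank_homSpace_mul_comm_right (hUnormal _) h₂ h₃ (h _ hm) ρ₁
      rw [mul_left_comm, this, mul_left_comm]
  · refine (min_le_right _ _).trans
      (ENNReal.tsum_weight_div_le (mul_ne_zero hd₂ hd₃) (mul_ne_zero hd₁ hd₃) fun m => ?_)
    by_cases hm : homSpace (U (m + 1)) ρ₂ ρ₃ = ⊥
    · rw [Submodule.finrank_eq_zero.mpr hm, zero_mul]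
      exact Nat.zero_le _
    · have := finrank_homSpace_mul_comm_left (hUnormal _) h₁ h₂ (h _ hm) ρ₃
      rw [← mul_assoc, this, mul_assoc]
end

section
/- Let G be a group, (U_m)_{m≥0} a decreasing sequence of normal subgroups of G, and w : ℕ → [0, ∞] a family of weights. For irreducible finite-dimensional complex representations π, π' of G set inv(π, π') := Σ_{m=1}^∞ w_m · dim Hom_{U_m}(π, π') ∈ [0, ∞]. Then for any two irreducible finite-dimensional complex representations π₁, π₂ of G, one has min( inv(π₁, π₁)/d_{π₁}², inv(π₂, π₂)/d_{π₂}² ) ≥ inv(π₁, π₂)/(d_{π₁} d_{π₂}), as an inequality in [0, ∞]. -/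
variable {G : Type*} [Group G]

open scoped ENNReal

/-- The linear maps intertwining two families of endomorphisms indexed by the same type. -/
def intertwiners {S A B : Type*} [AddCommGroup A] [Module ℂ A] [AddCommGroup B] [Module ℂ B]
    (a : S → Module.End ℂ A) (b : S → Module.End ℂ B) : Submodule ℂ (A →ₗ[ℂ] B) where
  carrier := {f | ∀ s v, f (a s v) = b s (f v)}
  add_mem' := by
    intro f g hf hg s v
    simp [hf s v, hg s v]
  zero_mem' := by intro s v; simp
  smul_mem' := by
    intro c f hf s v
    simp [hf s v]

section Intertwiners

variable {S A A' B B' : Type*} [AddCommGroup A] [Module ℂ A] [AddCommGroup A'] [Module ℂ A']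
  [AddCommGroup B] [Module ℂ B] [AddCommGroup B'] [Module ℂ B']

theorem mem_intertwiners {a : S → Module.End ℂ A} {b : S → Module.End ℂ B} {f : A →ₗ[ℂ] B} :
    f ∈ intertwiners a b ↔ ∀ s v, f (a s v) = b s (f v) := Iff.rfl

/-- Intertwiner spaces are preserved by isomorphisms, even up to a common reindexing of the
operators. -/
theorem finrank_intertwiners_congr {a : S → Module.End ℂ A} {a' : S → Module.End ℂ A'}
    {b : S → Module.End ℂ B} {b' : S → Module.End ℂ B'} (φ : S ≃ S) (e : A ≃ₗ[ℂ] A')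
    (d : B ≃ₗ[ℂ] B') (he : ∀ s v, e (a s v) = a' (φ s) (e v))
    (hd : ∀ s v, d (b s v) = b' (φ s) (d v)) :
    Module.finrank ℂ (intertwiners a b) = Module.finrank ℂ (intertwiners a' b') := by
  have hmap : (intertwiners a b).map (e.arrowCongr d).toLinearMap = intertwiners a' b' := by
    ext f
    rw [Submodule.mem_map_equiv, mem_intertwiners, mem_intertwiners]
    constructor
    · intro h s v
      have := congrArg d (h (φ.symm s) (e.symm v))
      simpa [LinearEquiv.arrowCongr_symm_apply, he, hd] using this
    · intro h s v
      apply d.injective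
      simp [LinearEquiv.arrowCongr_symm_apply, he, hd, h]
  rw [← hmap]
  exact ((e.arrowCongr d).submoduleMap _).finrank_eq

/-- A product of submodules is the product of the underlying modules. -/
def submoduleProdEquiv (p : Submodule ℂ A) (q : Submodule ℂ B) : p.prod q ≃ₗ[ℂ] p × q where
  toFun x := (⟨x.1.1, x.2.1⟩, ⟨x.1.2, x.2.2⟩)
  invFun x := ⟨(x.1, x.2), x.1.2, x.2.2⟩
  map_add' _ _ := rfl
  map_smul' _ _ := rfl
  left_inv _ := rfl
  right_inv _ := rfl

theorem finrank_intertwiners_prod_left [FiniteDimensional ℂ A] [FiniteDimensional ℂ A']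
    [FiniteDimensional ℂ B] (a : S → Module.End ℂ A) (a' : S → Module.End ℂ A')
    (b : S → Module.End ℂ B) :
    Module.finrank ℂ (intertwiners (fun s => (a s).prodMap (a' s)) b) =
      Module.finrank ℂ (intertwiners a b) + Module.finrank ℂ (intertwiners a' b) := by
  have hmap : ((intertwiners a b).prod (intertwiners a' b)).map
      (LinearMap.coprodEquiv ℂ (R := ℂ) (M := A) (M₂ := A') (M₃ := B)).toLinearMap =
      intertwiners (fun s => (a s).prodMap (a' s)) b := by
    ext f
    rw [Submodule.mem_map_equiv, Submodule.mem_prod, mem_intertwiners, mem_intertwiners,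
      mem_intertwiners]
    constructor
    · rintro ⟨h, h'⟩ s ⟨v, v'⟩
      have h1 : f (a s v, 0) = b s (f (v, 0)) := h s v
      have h2 : f (0, a' s v') = b s (f (0, v')) := h' s v'
      have h3 : ((a s).prodMap (a' s)) (v, v') = (a s v, 0) + (0, a' s v') := by simp
      have h4 : (v, v') = (v, 0) + (0, v') := by simp
      rw [h3, h4, map_add, map_add, map_add, h1, h2]
    · intro h
      exact ⟨fun s v => by simpa using h s (v, 0), fun s v => by simpa using h s (0, v)⟩
  rw [← hmap, ← Module.finrank_prod]
  exact ((LinearEquiv.submoduleMap _ _).symm.trans (submoduleProdEquiv _ _)).finrank_eq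

theorem finrank_intertwiners_prod_right [FiniteDimensional ℂ A] [FiniteDimensional ℂ B]
    [FiniteDimensional ℂ B'] (a : S → Module.End ℂ A) (b : S → Module.End ℂ B)
    (b' : S → Module.End ℂ B') :
    Module.finrank ℂ (intertwiners a (fun s => (b s).prodMap (b' s))) =
      Module.finrank ℂ (intertwiners a b) + Module.finrank ℂ (intertwiners a b') := by
  have hmap : ((intertwiners a b).prod (intertwiners a b')).map
      (LinearMap.prodEquiv ℂ (R := ℂ) (M := A) (M₂ := B) (M₃ := B')).toLinearMap =
      intertwiners a (fun s => (b s).prodMap (b' s)) := by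
    ext f
    rw [Submodule.mem_map_equiv, Submodule.mem_prod, mem_intertwiners, mem_intertwiners,
      mem_intertwiners]
    constructor
    · rintro ⟨h, h'⟩ s v
      exact Prod.ext (h s v) (h' s v)
    · intro h
      exact ⟨fun s v => congrArg Prod.fst (h s v), fun s v => congrArg Prod.snd (h s v)⟩
  rw [← hmap, ← Module.finrank_prod]
  exact ((LinearEquiv.submoduleMap _ _).symm.trans (submoduleProdEquiv _ _)).finrank_eq

/-- `N` is stable under all the operators `a s`. -/
def IsStable (a : S → Module.End ℂ A) (N : Submodule ℂ A) : Prop :=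
  ∀ s, ∀ v ∈ N, a s v ∈ N

/-- The operators induced on a stable subspace. -/
def IsStable.restrict {a : S → Module.End ℂ A} {N : Submodule ℂ A} (h : IsStable a N) :
    S → Module.End ℂ N :=
  fun s => (a s).restrict (h s)

@[simp]
theorem IsStable.coe_restrict_apply {a : S → Module.End ℂ A} {N : Submodule ℂ A}
    (h : IsStable a N) (s : S) (v : N) : (h.restrict s v : A) = a s v := rfl

/-- `N` is a minimal nonzero stable subspace. -/
structure IsMinimalStable (a : S → Module.End ℂ A) (N : Submodule ℂ A) : Prop where
  stable : IsStable a N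
  ne_bot : N ≠ ⊥
  eq_bot_or_eq : ∀ p, IsStable a p → p ≤ N → p = ⊥ ∨ p = N

theorem IsStable.inf {a : S → Module.End ℂ A} {N M : Submodule ℂ A} (hN : IsStable a N)
    (hM : IsStable a M) : IsStable a (N ⊓ M) :=
  fun s v hv => ⟨hN s v hv.1, hM s v hv.2⟩

theorem IsStable.sup {a : S → Module.End ℂ A} {N M : Submodule ℂ A} (hN : IsStable a N)
    (hM : IsStable a M) : IsStable a (N ⊔ M) := by
  intro s v hv
  obtain ⟨x, hx, y, hy, rfl⟩ := Submodule.mem_sup.1 hv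
  rw [map_add]
  exact Submodule.add_mem_sup (hN s x hx) (hM s y hy)

theorem exists_isMinimalStable [FiniteDimensional ℂ A] [Nontrivial A]
    (a : S → Module.End ℂ A) : ∃ N, IsMinimalStable a N := by
  obtain ⟨N, ⟨hN, hN0⟩, hmin⟩ := wellFounded_lt.has_min
    {N : Submodule ℂ A | IsStable a N ∧ N ≠ ⊥} ⟨⊤, fun _ _ _ => trivial, top_ne_bot⟩
  refine ⟨N, hN, hN0, fun p hp hpN => ?_⟩
  by_contra! h
  exact hmin p ⟨hp, h.1⟩ (lt_of_le_of_ne hpN h.2)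

/-- The image of a minimal stable subspace under a semi-equivariant isomorphism is minimal
stable. -/
theorem IsMinimalStable.map_equiv {a : S → Module.End ℂ A} {a' : S → Module.End ℂ A'}
    {N : Submodule ℂ A} (hN : IsMinimalStable a N) (φ : S ≃ S) (e : A ≃ₗ[ℂ] A')
    (he : ∀ s v, e (a s v) = a' (φ s) (e v)) : IsMinimalStable a' (N.map e.toLinearMap) := by
  refine ⟨?_, ?_, fun p hp hpN => ?_⟩
  · rintro s _ ⟨v, hv, rfl⟩
    exact ⟨a (φ.symm s) v, hN.stable _ v hv, by simp [he]⟩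
  · simpa [Submodule.map_eq_bot_iff] using hN.ne_bot
  · have hcomap : IsStable a (p.comap e.toLinearMap) := by
      intro s v hv
      simpa [he] using hp (φ s) (e v) hv
    have hmap : (p.comap e.toLinearMap).map e.toLinearMap = p :=
      Submodule.map_comap_eq_of_surjective e.surjective p
    have hle : p.comap e.toLinearMap ≤ N := by
      rw [← Submodule.comap_map_eq_of_injective e.injective N]
      exact Submodule.comap_mono hpN
    rcases hN.eq_bot_or_eq _ hcomap hle with h | h
    · left; rw [← hmap, h, Submodule.map_bot]
    · right; rw [← hmap, h]

/-- The image of a minimal stable subspace under an intertwiner not vanishing on it is an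
isomorphic minimal stable subspace. -/
theorem IsMinimalStable.exists_equiv_map {a : S → Module.End ℂ A} {b : S → Module.End ℂ B}
    {N : Submodule ℂ A} (hN : IsMinimalStable a N) {f : A →ₗ[ℂ] B} (hf : f ∈ intertwiners a b)
    (hNf : ¬ N ≤ LinearMap.ker f) :
    ∃ (M : Submodule ℂ B) (hM : IsMinimalStable b M) (e : N ≃ₗ[ℂ] M),
      ∀ s v, e (hN.stable.restrict s v) = hM.stable.restrict s (e v) := by
  have hker : IsStable a (LinearMap.ker f) := by
    intro s v hv
    rw [LinearMap.mem_ker] at hv ⊢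
    rw [hf s v, hv, map_zero]
  have hdisj : N ⊓ LinearMap.ker f = ⊥ := by
    rcases hN.eq_bot_or_eq _ (hN.stable.inf hker) inf_le_left with h | h
    · exact h
    · exact absurd (inf_eq_left.1 h) hNf
  have hinj : Function.Injective (f.domRestrict N) := by
    rw [← LinearMap.ker_eq_bot, eq_bot_iff]
    rintro ⟨v, hv⟩ hvf
    have : v ∈ N ⊓ LinearMap.ker f := ⟨hv, hvf⟩
    rw [hdisj, Submodule.mem_bot] at this
    exact (Submodule.mem_bot ℂ).2 (Subtype.ext this)
  refine ⟨LinearMap.range (f.domRestrict N), ⟨?_, ?_, fun p hp hpN => ?_⟩,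
    LinearEquiv.ofInjective _ hinj, fun s v => Subtype.ext (hf s v)⟩
  · rintro s _ ⟨v, rfl⟩
    exact ⟨hN.stable.restrict s v, hf s v⟩
  · intro h
    apply hNf
    intro v hv
    have : f.domRestrict N ⟨v, hv⟩ ∈ LinearMap.range (f.domRestrict N) := ⟨_, rfl⟩
    rw [h, Submodule.mem_bot] at this
    exact this
  · have hcomap : IsStable a (N ⊓ p.comap f) := by
      refine hN.stable.inf fun s v hv => ?_
      rw [Submodule.mem_comap, hf s v]
      exact hp s _ hv
    rcases hN.eq_bot_or_eq _ hcomap inf_le_left with h | h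
    · left
      rw [eq_bot_iff]
      intro x hx
      obtain ⟨v, rfl⟩ := hpN hx
      have : (v : A) ∈ N ⊓ p.comap f := ⟨v.2, hx⟩
      rw [h, Submodule.mem_bot] at this
      simp [this]
    · right
      refine le_antisymm hpN ?_
      rintro _ ⟨v, rfl⟩
      exact (inf_eq_left.1 h) v.2

end Intertwiners

section Clifford

variable {V X : Type*} [AddCommGroup V] [Module ℂ V] [AddCommGroup X] [Module ℂ X]

/-- The operators by which the elements of a subgroup act. -/
def restrictOps (H : Subgroup G) (ρ : Representation ℂ G V) : H → Module.End ℂ V :=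
  fun s => ρ s

theorem homSpace_eq_intertwiners (H : Subgroup G) (ρ : Representation ℂ G V)
    (τ : Representation ℂ G X) :
    homSpace H ρ τ = intertwiners (restrictOps H ρ) (restrictOps H τ) := by
  ext f
  exact ⟨fun h s v => h s s.2 v, fun h s hs v => h ⟨s, hs⟩ v⟩

/-- The operator of `g`, as a linear automorphism. -/
def opEquiv (ρ : Representation ℂ G V) (g : G) : V ≃ₗ[ℂ] V :=
  LinearEquiv.ofLinearMap (ρ g) (ρ g⁻¹) (by ext; simp) (by ext; simp)

@[simp]
theorem opEquiv_apply (ρ : Representation ℂ G V) (g : G) (v : V) : opEquiv ρ g v = ρ g v := rfl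

theorem opEquiv_restrictOps (H : Subgroup G) [H.Normal] (ρ : Representation ℂ G V) (g : G)
    (s : H) (v : V) : opEquiv ρ g (restrictOps H ρ s v) =
      restrictOps H ρ ((MulAut.conjNormal g).toEquiv s) (opEquiv ρ g v) := by
  simp [restrictOps, ← Module.End.mul_apply, ← map_mul]

/-- A nonzero subspace and its translates span an irreducible representation, so some translate
escapes any given proper subspace. -/
theorem IsIrrep.exists_translate_not_le {ρ : Representation ℂ G V} (h : IsIrrep ρ)
    {W N : Submodule ℂ V} (hW : W ≠ ⊥) (hN : N ≠ ⊤) :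
    ∃ g, ¬ W.map (opEquiv ρ g).toLinearMap ≤ N := by
  by_contra! hall
  have hstable : ∀ g : G, ∀ v ∈ ⨆ g, W.map (opEquiv ρ g).toLinearMap,
      ρ g v ∈ ⨆ g, W.map (opEquiv ρ g).toLinearMap := by
    intro g v hv
    have hle : (⨆ g, W.map (opEquiv ρ g).toLinearMap) ≤
        (⨆ g, W.map (opEquiv ρ g).toLinearMap).comap (ρ g) := by
      refine iSup_le fun k => ?_
      rintro _ ⟨x, hx, rfl⟩
      exact Submodule.mem_iSup_of_mem (g * k) ⟨x, hx, by simp⟩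
    exact hle hv
  rcases h.2 _ hstable with hbot | htop
  · apply hW
    have := (iSup_eq_bot.1 hbot) 1
    simpa [Submodule.map_eq_bot_iff] using this
  · exact hN (top_le_iff.1 (htop ▸ iSup_le hall))

/-- The intertwiners into and out of `N` have the dimensions they would have if `N` were a sum
of `dim N / dim W` translates of `W`. -/
def HasProportionalHoms (H : Subgroup G) (ρ : Representation ℂ G V) (τ : Representation ℂ G X)
    {W N : Submodule ℂ V} (hW : IsStable (restrictOps H ρ) W)
    (hN : IsStable (restrictOps H ρ) N) : Prop :=
  Module.finrank ℂ (intertwiners hN.restrict (restrictOps H τ)) * Module.finrank ℂ W =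
      Module.finrank ℂ N * Module.finrank ℂ (intertwiners hW.restrict (restrictOps H τ)) ∧
    Module.finrank ℂ (intertwiners (restrictOps H τ) hN.restrict) * Module.finrank ℂ W =
      Module.finrank ℂ N * Module.finrank ℂ (intertwiners (restrictOps H τ) hW.restrict)

theorem HasProportionalHoms.translate (H : Subgroup G) [H.Normal] (ρ : Representation ℂ G V)
    (τ : Representation ℂ G X) {W : Submodule ℂ V} (hW : IsStable (restrictOps H ρ) W) (g : G)
    (hg : IsStable (restrictOps H ρ) (W.map (opEquiv ρ g).toLinearMap)) :
    HasProportionalHoms H ρ τ hW hg := by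
  have he : ∀ s v, (opEquiv ρ g).submoduleMap W (hW.restrict s v) =
      hg.restrict ((MulAut.conjNormal g).toEquiv s) ((opEquiv ρ g).submoduleMap W v) :=
    fun s v => Subtype.ext (opEquiv_restrictOps H ρ g s v)
  have hd := opEquiv_restrictOps H τ g
  constructor
  · rw [finrank_intertwiners_congr _ _ _ he hd, ((opEquiv ρ g).submoduleMap W).finrank_eq,
      mul_comm]
  · rw [finrank_intertwiners_congr _ _ _ hd he, ((opEquiv ρ g).submoduleMap W).finrank_eq,
      mul_comm]

variable [FiniteDimensional ℂ V] [FiniteDimensional ℂ X]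

theorem HasProportionalHoms.sup {H : Subgroup G} {ρ : Representation ℂ G V}
    {τ : Representation ℂ G X} {W N M : Submodule ℂ V} {hW : IsStable (restrictOps H ρ) W}
    {hN : IsStable (restrictOps H ρ) N} {hM : IsStable (restrictOps H ρ) M}
    (h : HasProportionalHoms H ρ τ hW hN) (h' : HasProportionalHoms H ρ τ hW hM)
    (hdisj : Disjoint N M) : HasProportionalHoms H ρ τ hW (hN.sup hM) := by
  have hinj : Function.Injective (N.subtype.coprod M.subtype) := by
    rw [← LinearMap.ker_eq_bot, LinearMap.ker_coprod_of_disjoint_range] <;> simp [hdisj]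
  let e : (N × M) ≃ₗ[ℂ] (N ⊔ M : Submodule ℂ V) :=
    (LinearEquiv.ofInjective _ hinj).trans
      (LinearEquiv.ofEq _ _ (by simp [LinearMap.range_coprod]))
  have hcoe : ∀ v, (e v : V) = v.1 + v.2 := fun v => rfl
  have he : ∀ s v, e ((hN.restrict s).prodMap (hM.restrict s) v) =
      (hN.sup hM).restrict (Equiv.refl H s) (e v) := by
    intro s v
    apply Subtype.ext
    simp [hcoe]
  have hd : ∀ s v, LinearEquiv.refl ℂ X (restrictOps H τ s v) =
      restrictOps H τ (Equiv.refl H s) (LinearEquiv.refl ℂ X v) := fun _ _ => rfl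
  constructor
  · rw [← finrank_intertwiners_congr _ _ _ he hd, finrank_intertwiners_prod_left,
      ← e.finrank_eq, Module.finrank_prod, add_mul, add_mul, h.1, h'.1]
  · rw [← finrank_intertwiners_congr _ _ _ hd he, finrank_intertwiners_prod_right,
      ← e.finrank_eq, Module.finrank_prod, add_mul, add_mul, h.2, h'.2]

/-- In an irreducible representation, any subspace with proportional intertwiners can be enlarged
to the whole space by adding translates of `W`. -/
theorem IsIrrep.hasProportionalHoms_top {H : Subgroup G} [H.Normal] {ρ : Representation ℂ G V}
    (hρ : IsIrrep ρ) (τ : Representation ℂ G X) {W : Submodule ℂ V}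
    (hW : IsMinimalStable (restrictOps H ρ) W) (N : Submodule ℂ V)
    (hN : IsStable (restrictOps H ρ) N) (h : HasProportionalHoms H ρ τ hW.stable hN) :
    ∃ hT : IsStable (restrictOps H ρ) ⊤, HasProportionalHoms H ρ τ hW.stable hT := by
  induction N using WellFoundedGT.induction with
  | ind N ih =>
    by_cases hNT : N = ⊤
    · subst hNT
      exact ⟨hN, h⟩
    obtain ⟨g, hg⟩ := hρ.exists_translate_not_le hW.ne_bot hNT
    have hM := hW.map_equiv _ _ (opEquiv_restrictOps H ρ g)
    have hdisj : Disjoint N (W.map (opEquiv ρ g).toLinearMap) := by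
      rw [disjoint_iff]
      rcases hM.eq_bot_or_eq _ (hN.inf hM.stable) inf_le_right with h' | h'
      · exact h'
      · exact absurd (inf_eq_right.1 h') hg
    exact ih _ (left_lt_sup.2 hg) (hN.sup hM.stable)
      (h.sup (HasProportionalHoms.translate H ρ τ hW.stable g hM.stable) hdisj)

/-- The restriction of an irreducible representation to a normal subgroup behaves, for the purpose
of counting intertwiners, like a multiple of any of its minimal stable subspaces. -/
theorem IsIrrep.finrank_homSpace_mul {H : Subgroup G} [H.Normal] {ρ : Representation ℂ G V}
    (hρ : IsIrrep ρ) (τ : Representation ℂ G X) {W : Submodule ℂ V}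
    (hW : IsMinimalStable (restrictOps H ρ) W) :
    Module.finrank ℂ (homSpace H ρ τ) * Module.finrank ℂ W = Module.finrank ℂ V *
        Module.finrank ℂ (intertwiners hW.stable.restrict (restrictOps H τ)) ∧
      Module.finrank ℂ (homSpace H τ ρ) * Module.finrank ℂ W = Module.finrank ℂ V *
        Module.finrank ℂ (intertwiners (restrictOps H τ) hW.stable.restrict) := by
  have hgW : IsStable (restrictOps H ρ) (W.map (opEquiv ρ 1).toLinearMap) :=
    (hW.map_equiv _ _ (opEquiv_restrictOps H ρ 1)).stable
  obtain ⟨hT, h⟩ := hρ.hasProportionalHoms_top τ hW _ hgW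
    (HasProportionalHoms.translate H ρ τ hW.stable 1 hgW)
  have he : ∀ s v, Submodule.topEquiv (hT.restrict s v) =
      restrictOps H ρ (Equiv.refl H s) (Submodule.topEquiv v) := fun _ _ => rfl
  have hd : ∀ s v, LinearEquiv.refl ℂ X (restrictOps H τ s v) =
      restrictOps H τ (Equiv.refl H s) (LinearEquiv.refl ℂ X v) := fun _ _ => rfl
  rw [homSpace_eq_intertwiners, homSpace_eq_intertwiners,
    ← finrank_intertwiners_congr _ _ _ he hd, ← finrank_intertwiners_congr _ _ _ hd he,
    ← (Submodule.topEquiv (R := ℂ) (M := V)).finrank_eq]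
  exact h

end Clifford

section Comparison

variable {V₁ V₂ : Type*} [AddCommGroup V₁] [Module ℂ V₁] [FiniteDimensional ℂ V₁]
  [AddCommGroup V₂] [Module ℂ V₂] [FiniteDimensional ℂ V₂]

theorem finrank_homSpace_mul_le (H : Subgroup G) [H.Normal] {ρ₁ : Representation ℂ G V₁}
    {ρ₂ : Representation ℂ G V₂} (h₁ : IsIrrep ρ₁) (h₂ : IsIrrep ρ₂) :
    Module.finrank ℂ (homSpace H ρ₁ ρ₂) * Module.finrank ℂ V₁ ≤
        Module.finrank ℂ (homSpace H ρ₁ ρ₁) * Module.finrank ℂ V₂ ∧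
      Module.finrank ℂ (homSpace H ρ₁ ρ₂) * Module.finrank ℂ V₂ ≤
        Module.finrank ℂ (homSpace H ρ₂ ρ₂) * Module.finrank ℂ V₁ := by
  by_cases hzero : homSpace H ρ₁ ρ₂ = ⊥
  · rw [hzero, finrank_bot]
    simp
  obtain ⟨f, hf, hf0⟩ := Submodule.exists_mem_ne_zero_of_ne_bot hzero
  rw [homSpace_eq_intertwiners] at hf
  have := h₁.1
  obtain ⟨W, hW⟩ := exists_isMinimalStable (restrictOps H ρ₁)
  obtain ⟨g, hg⟩ := h₁.exists_translate_not_le hW.ne_bot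
    (mt LinearMap.ker_eq_top.1 hf0)
  have hW₁ := hW.map_equiv _ _ (opEquiv_restrictOps H ρ₁ g)
  generalize W.map (opEquiv ρ₁ g).toLinearMap = W₁ at hg hW₁
  obtain ⟨W₂, hW₂, e, he⟩ := hW₁.exists_equiv_map hf hg
  have hpos : 0 < Module.finrank ℂ W₂ :=
    Nat.pos_of_ne_zero fun h => hW₂.ne_bot (Submodule.finrank_eq_zero.1 h)
  have hleft := finrank_intertwiners_congr (b := restrictOps H ρ₂) (b' := restrictOps H ρ₂)
    (Equiv.refl H) e (LinearEquiv.refl ℂ V₂) he fun _ _ => rfl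
  have hright := finrank_intertwiners_congr (a := restrictOps H ρ₁) (a' := restrictOps H ρ₁)
    (Equiv.refl H) (LinearEquiv.refl ℂ V₁) e (fun _ _ => rfl) he
  have h12 := (h₁.finrank_homSpace_mul ρ₂ hW₁).1
  have h22 := (h₂.finrank_homSpace_mul ρ₂ hW₂).1
  have h11 := (h₁.finrank_homSpace_mul ρ₁ hW₁).2
  have h12' := (h₂.finrank_homSpace_mul ρ₁ hW₂).2
  rw [e.finrank_eq, hleft] at h12
  rw [e.finrank_eq, hright] at h11
  constructor
  · refine (Nat.eq_of_mul_eq_mul_right hpos ?_).le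
    rw [mul_right_comm, h12', mul_right_comm (Module.finrank ℂ (homSpace H ρ₁ ρ₁)), h11]
    ring
  · refine (Nat.eq_of_mul_eq_mul_right hpos ?_).le
    rw [mul_right_comm, h12, mul_right_comm (Module.finrank ℂ (homSpace H ρ₂ ρ₂)), h22]
    ring

end Comparison

theorem ENNReal.tsum_mul_natCast_mul_le {w : ℕ → ℝ≥0∞} {a b : ℕ → ℕ} {c d : ℕ}
    (h : ∀ m, a m * c ≤ b m * d) :
    (∑' m, w m * (a m : ℝ≥0∞)) * c ≤ (∑' m, w m * (b m : ℝ≥0∞)) * d := by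
  rw [← ENNReal.tsum_mul_right, ← ENNReal.tsum_mul_right]
  refine ENNReal.tsum_le_tsum fun m => ?_
  rw [mul_assoc, mul_assoc]
  refine mul_le_mul_right ?_ _
  exact_mod_cast h m

theorem ENNReal.div_mul_le_div_mul_self {x y : ℝ≥0∞} {c d : ℕ} (hc : c ≠ 0) (hd : d ≠ 0)
    (h : x * c ≤ y * d) : x / ((c : ℝ≥0∞) * d) ≤ y / ((c : ℝ≥0∞) * c) := by
  have hc' : (c : ℝ≥0∞) ≠ 0 := by exact_mod_cast hc
  have hd' : (d : ℝ≥0∞) ≠ 0 := by exact_mod_cast hd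
  rw [← ENNReal.mul_div_mul_right x _ hc' (ENNReal.natCast_ne_top c),
    ← ENNReal.mul_div_mul_right y _ hd' (ENNReal.natCast_ne_top d), mul_right_comm (c : ℝ≥0∞)]
  exact ENNReal.div_le_div_right h _

/-- `min(inv(π₁,π₁)/d₁², inv(π₂,π₂)/d₂²) ≥ inv(π₁,π₂)/(d₁d₂)` in `[0, ∞]`. -/
theorem stmt10 {V₁ V₂ : Type*} [AddCommGroup V₁] [Module ℂ V₁] [FiniteDimensional ℂ V₁]
    [AddCommGroup V₂] [Module ℂ V₂] [FiniteDimensional ℂ V₂]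
    (U : ℕ → Subgroup G) (hU : Antitone U) (hUnormal : ∀ m, (U m).Normal)
    (w : ℕ → ℝ≥0∞)
    (ρ₁ : Representation ℂ G V₁) (ρ₂ : Representation ℂ G V₂)
    (h₁ : IsIrrep ρ₁) (h₂ : IsIrrep ρ₂) :
    min (invW U w ρ₁ ρ₁ / ((Module.finrank ℂ V₁ : ℝ≥0∞) * (Module.finrank ℂ V₁ : ℝ≥0∞)))
        (invW U w ρ₂ ρ₂ / ((Module.finrank ℂ V₂ : ℝ≥0∞) * (Module.finrank ℂ V₂ : ℝ≥0∞))) ≥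
      invW U w ρ₁ ρ₂ / ((Module.finrank ℂ V₁ : ℝ≥0∞) * (Module.finrank ℂ V₂ : ℝ≥0∞)) := by
  have : Nontrivial V₁ := h₁.1
  have : Nontrivial V₂ := h₂.1
  have hd₁ : Module.finrank ℂ V₁ ≠ 0 := Module.finrank_pos.ne'
  have hd₂ : Module.finrank ℂ V₂ ≠ 0 := Module.finrank_pos.ne'
  have key := fun m => have := hUnormal (m + 1); finrank_homSpace_mul_le (U (m + 1)) h₁ h₂
  refine le_min ?_ ?_
  · exact ENNReal.div_mul_le_div_mul_self hd₁ hd₂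
      (ENNReal.tsum_mul_natCast_mul_le fun m => (key m).1)
  · rw [mul_comm (Module.finrank ℂ V₁ : ℝ≥0∞)]
    exact ENNReal.div_mul_le_div_mul_self hd₂ hd₁
      (ENNReal.tsum_mul_natCast_mul_le fun m => (key m).2)
end
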